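/- arXiv:1308.0154 — 2 statements merged into one kernel-verified Lean document; each statement's English description precedes it below -/
import Mathlib

section
/- Let k be a field and F a bad field generator of A = k[X,Y]. Then F is not a variable of A, F is a rectangular element of A, and the pair (m,n) = bideg_A(F) satisfies 2 ≤ m ≤ n. -/
theorem exists_eq_const_add_of_mem_adjoin_pair {k R : Type*} [CommRing k] [CommRing R] [Algebra k R]
    {x y h : R} (hh : h ∈ Algebra.adjoin k {x, y}) :
    ∃ c : k, ∃ h₁ ∈ Algebra.adjoin k {x, y}, ∃ h₂ ∈ Algebra.adjoin k {x, y},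
      h = algebraMap k R c + x * h₁ + y * h₂ := by
  induction hh using Algebra.adjoin_induction with
  | mem z hz =>
    rcases hz with rfl | rfl
    · exact ⟨0, 1, one_mem _, 0, zero_mem _, by simp⟩
    · exact ⟨0, 0, zero_mem _, 1, one_mem _, by simp⟩
  | algebraMap r => exact ⟨r, 0, zero_mem _, 0, zero_mem _, by simp⟩
  | add f g hf hg ihf ihg =>
    obtain ⟨c, f₁, hf₁, f₂, hf₂, rfl⟩ := ihf
    obtain ⟨c', g₁, hg₁, g₂, hg₂, rfl⟩ := ihg
    exact ⟨c + c', f₁ + g₁, add_mem hf₁ hg₁, f₂ + g₂, add_mem hf₂ hg₂, by rw [map_add]; ring⟩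
  | mul f g hf hg ihf ihg =>
    obtain ⟨c, f₁, hf₁, f₂, hf₂, rfl⟩ := ihf
    obtain ⟨c', g₁, hg₁, g₂, hg₂, rfl⟩ := ihg
    refine ⟨c * c', algebraMap k R c * g₁ + f₁ * (algebraMap k R c' + x * g₁ + y * g₂),
      add_mem (mul_mem (Subalgebra.algebraMap_mem _ _) hg₁) (mul_mem hf₁ hg),
      algebraMap k R c * g₂ + f₂ * (algebraMap k R c' + x * g₁ + y * g₂),
      add_mem (mul_mem (Subalgebra.algebraMap_mem _ _) hg₂) (mul_mem hf₂ hg), ?_⟩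
    rw [map_mul]; ring

theorem exists_eq_aeval_add_of_mem_adjoin_pair {k R : Type*} [CommRing k] [CommRing R] [Algebra k R]
    {x y h : R} (hh : h ∈ Algebra.adjoin k {x, y}) :
    ∃ P : Polynomial k, ∃ h₁ ∈ Algebra.adjoin k {x, y},
      h = Polynomial.aeval y P + x * h₁ := by
  have hy (P : Polynomial k) : Polynomial.aeval y P ∈ Algebra.adjoin k {x, y} :=
    Algebra.adjoin_mono (by simp) (Polynomial.aeval_mem_adjoin_singleton k y)
  induction hh using Algebra.adjoin_induction with
  | mem z hz =>
    rcases hz with rfl | rfl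
    · exact ⟨0, 1, one_mem _, by simp⟩
    · exact ⟨Polynomial.X, 0, zero_mem _, by simp⟩
  | algebraMap r => exact ⟨Polynomial.C r, 0, zero_mem _, by simp⟩
  | add f g hf hg ihf ihg =>
    obtain ⟨c, f₁, hf₁, rfl⟩ := ihf
    obtain ⟨c', g₁, hg₁, rfl⟩ := ihg
    exact ⟨c + c', f₁ + g₁, add_mem hf₁ hg₁, by rw [map_add]; ring⟩
  | mul f g hf hg ihf ihg =>
    obtain ⟨c, f₁, hf₁, rfl⟩ := ihf
    obtain ⟨c', g₁, hg₁, rfl⟩ := ihg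
    refine ⟨c * c', Polynomial.aeval y c * g₁ + f₁ * (Polynomial.aeval y c' + x * g₁),
      add_mem (mul_mem (hy c) hg₁) (mul_mem hf₁ hg), ?_⟩
    rw [map_mul]; ring

theorem adjoin_pair_le_of_eq_mul {k R : Type*} [CommRing k] [CommRing R] [Algebra k R]
    {x y z : R} (h : y = x * z) : Algebra.adjoin k {x, y} ≤ Algebra.adjoin k {x, z} := by
  refine Algebra.adjoin_le ?_
  have hx : x ∈ Algebra.adjoin k {x, z} := Algebra.subset_adjoin (by simp)
  have hz : z ∈ Algebra.adjoin k {x, z} := Algebra.subset_adjoin (by simp)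
  rintro w (rfl | rfl)
  · exact hx
  · rw [h]; exact mul_mem hx hz

open PowerSeries in
theorem blowup_step {k κ : Type*} [Field k] [Field κ] [Algebra k κ] {Z : κ}
    {x y z g h : κ⟦X⟧} {N : ℕ} (hyz : y = x * z)
    (hx : constantCoeff x = 0) (hZ : Z ∉ (algebraMap k κ).range)
    (hg : g ∈ Algebra.adjoin k {x, y}) (hh : h ∈ Algebra.adjoin k {x, y})
    (hN : ¬ (X : κ⟦X⟧) ^ (N + 1) ∣ h) (hgh : g = C Z * h) :
    ∃ g₁ ∈ Algebra.adjoin k {x, z}, ∃ h₁ ∈ Algebra.adjoin k {x, z},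
      ¬ (X : κ⟦X⟧) ^ N ∣ h₁ ∧ g₁ = C Z * h₁ := by
  have hle := adjoin_pair_le_of_eq_mul (k := k) hyz
  have hz : z ∈ Algebra.adjoin k {x, z} := Algebra.subset_adjoin (by simp)
  obtain ⟨c, g₁, hg₁, g₂, hg₂, rfl⟩ := exists_eq_const_add_of_mem_adjoin_pair hg
  obtain ⟨c', h₁, hh₁, h₂, hh₂, rfl⟩ := exists_eq_const_add_of_mem_adjoin_pair hh
  have hy : constantCoeff y = 0 := by rw [hyz, map_mul, hx, zero_mul]
  have hcc := congrArg constantCoeff hgh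
  have key (c : k) : constantCoeff (algebraMap k κ⟦X⟧ c) = algebraMap k κ c := by
    rw [IsScalarTower.algebraMap_apply k κ κ⟦X⟧]; simp
  simp only [map_add, map_mul, hx, hy, zero_mul, add_zero, key, constantCoeff_C] at hcc
  have hc' : c' = 0 := by
    by_contra hc'
    have hne : algebraMap k κ c' ≠ 0 := by simpa using hc'
    exact hZ ⟨c / c', by rw [map_div₀, hcc, mul_div_cancel_right₀ _ hne]⟩
  have hc : c = 0 := by simpa [hc'] using hcc
  subst hc hc'
  have e₁ : algebraMap k κ⟦X⟧ 0 + x * h₁ + y * h₂ = x * (h₁ + z * h₂) := by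
    rw [hyz, map_zero]; ring
  have e₂ : algebraMap k κ⟦X⟧ 0 + x * g₁ + y * g₂ = x * (g₁ + z * g₂) := by
    rw [hyz, map_zero]; ring
  rw [e₁] at hN hgh
  rw [e₂] at hgh
  have hx0 : x ≠ 0 := by
    rintro rfl
    simp at hN
  refine ⟨g₁ + z * g₂, add_mem (hle hg₁) (mul_mem hz (hle hg₂)), h₁ + z * h₂,
    add_mem (hle hh₁) (mul_mem hz (hle hh₂)), fun hd ↦ hN ?_, ?_⟩
  · rw [pow_succ']
    exact mul_dvd_mul (X_dvd_iff.2 hx) hd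
  · apply mul_left_cancel₀ hx0
    rw [hgh]; ring

open PowerSeries in
theorem blowup {k κ : Type*} [Field k] [Field κ] [Algebra k κ] {Z : κ} (F : κ⟦X⟧)
    (hZ : Z ∉ (algebraMap k κ).range) (N : ℕ) : ∀ (x y u g h : κ⟦X⟧) (α β : ℕ) (c : k),
    constantCoeff x = 0 → F = x ^ α * y ^ β * u → constantCoeff u = algebraMap k κ c → c ≠ 0 →
    g ∈ Algebra.adjoin k {x, y} → h ∈ Algebra.adjoin k {x, y} → ¬ (X : κ⟦X⟧) ^ N ∣ h →
    g = C Z * h → ∃ (x' y' u' : κ⟦X⟧) (α' β' : ℕ) (c' : k), constantCoeff x' = 0 ∧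
      F = x' ^ α' * y' ^ β' * u' ∧ constantCoeff u' = algebraMap k κ c' ∧ c' ≠ 0 ∧
      Algebra.adjoin k {x, y} ≤ Algebra.adjoin k {x', y'} ∧
      constantCoeff y' ∉ (algebraMap k κ).range := by
  induction N with
  | zero => intro x y u g h α β c _ _ _ _ _ _ hN; simp at hN
  | succ N ih =>
    intro x y u g h α β c hx hF hu hc hg hh hN hgh
    wlog hy : constantCoeff y = 0 generalizing y u β c
    · by_cases hyr : constantCoeff y ∈ (algebraMap k κ).range
      · obtain ⟨b, hb⟩ := hyr
        have hb0 : b ≠ 0 := by rintro rfl; exact hy (by rw [← hb, map_zero])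
        have key : constantCoeff (algebraMap k κ⟦X⟧ b) = algebraMap k κ b := by
          rw [IsScalarTower.algebraMap_apply k κ κ⟦X⟧]; simp
        have hle : Algebra.adjoin k {x, y} ≤ Algebra.adjoin k {x, y - algebraMap k κ⟦X⟧ b} := by
          refine Algebra.adjoin_le ?_
          have hy' : y - algebraMap k κ⟦X⟧ b ∈
            Algebra.adjoin k {x, y - algebraMap k κ⟦X⟧ b} := Algebra.subset_adjoin (by simp)
          rintro w (rfl | rfl)
          · exact Algebra.subset_adjoin (by simp)
          · simpa using add_mem hy' (Subalgebra.algebraMap_mem _ b)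
        obtain ⟨x', y', u', α', β', c', h₁, h₂, h₃, h₄, h₅, h₆⟩ :=
          this (y - algebraMap k κ⟦X⟧ b) (y ^ β * u) 0 (b ^ β * c) (by rw [hF]; ring)
          (by rw [map_mul, map_pow, ← hb, hu, map_mul, map_pow])
          (mul_ne_zero (pow_ne_zero _ hb0) hc) (hle hg) (hle hh)
            (by rw [map_sub, key, hb, sub_self])
        exact ⟨x', y', u', α', β', c', h₁, h₂, h₃, h₄, hle.trans h₅, h₆⟩
      · exact ⟨x, y, u, α, β, c, hx, hF, hu, hc, le_rfl, hyr⟩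
    rcases ValuationRing.dvd_total x y with ⟨z, hz⟩ | ⟨z, hz⟩
    · obtain ⟨g₁, hg₁, h₁, hh₁, hN₁, hgh₁⟩ := blowup_step hz hx hZ hg hh hN hgh
      obtain ⟨x', y', u', α', β', c', h₁, h₂, h₃, h₄, h₅, h₆⟩ :=
        ih x z u g₁ h₁ (α + β) β c hx (by rw [hF, hz]; ring) hu hc hg₁ hh₁ hN₁ hgh₁
      exact ⟨x', y', u', α', β', c', h₁, h₂, h₃, h₄, (adjoin_pair_le_of_eq_mul hz).trans h₅, h₆⟩
    · rw [Set.pair_comm] at hg hh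
      obtain ⟨g₁, hg₁, h₁, hh₁, hN₁, hgh₁⟩ := blowup_step hz hy hZ hg hh hN hgh
      obtain ⟨x', y', u', α', β', c', h₁, h₂, h₃, h₄, h₅, h₆⟩ :=
        ih y z u g₁ h₁ (α + β) α c hy (by rw [hF, hz]; ring) hu hc hg₁ hh₁ hN₁ hgh₁
      rw [Set.pair_comm]
      exact ⟨x', y', u', α', β', c', h₁, h₂, h₃, h₄, (adjoin_pair_le_of_eq_mul hz).trans h₅, h₆⟩

open PowerSeries in
theorem constantCoeff_algebraMap_of_tower {k κ : Type*} [Field k] [Field κ] [Algebra k κ] (c : k) :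
    constantCoeff (algebraMap k κ⟦X⟧ c) = algebraMap k κ c := by
  rw [IsScalarTower.algebraMap_apply k κ κ⟦X⟧]; simp

open PowerSeries in
theorem constantCoeff_mem_adjoin {k κ : Type*} [Field k] [Field κ] [Algebra k κ]
    {x y h : κ⟦X⟧} (hx : constantCoeff x = 0) (hh : h ∈ Algebra.adjoin k {x, y}) :
    constantCoeff h ∈ Algebra.adjoin k {constantCoeff y} := by
  induction hh using Algebra.adjoin_induction with
  | mem z hz =>
    rcases hz with rfl | rfl
    · rw [hx]; exact zero_mem _
    · exact Algebra.subset_adjoin (by simp)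
  | algebraMap r =>
    rw [constantCoeff_algebraMap_of_tower]; exact Subalgebra.algebraMap_mem _ _
  | add f g hf hg ihf ihg => rw [map_add]; exact add_mem ihf ihg
  | mul f g hf hg ihf ihg => rw [map_mul]; exact mul_mem ihf ihg

open PowerSeries in
theorem exists_eq_pow_mul_of_mem_adjoin {k κ : Type*} [Field k] [Field κ] [Algebra k κ]
    {x y : κ⟦X⟧} (hx : constantCoeff x = 0) (hy : Transcendental k (constantCoeff y)) (N : ℕ) :
    ∀ h ∈ Algebra.adjoin k {x, y}, ¬ (X : κ⟦X⟧) ^ N ∣ h →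
    ∃ i, ∃ h₁, h = x ^ i * h₁ ∧ constantCoeff h₁ ≠ 0 ∧
      constantCoeff h₁ ∈ Algebra.adjoin k {constantCoeff y} := by
  induction N with
  | zero => intro h _ hN; simp at hN
  | succ N ih =>
    intro h hh hN
    by_cases h0 : constantCoeff h = 0
    · obtain ⟨P, h₁, hh₁, rfl⟩ := exists_eq_aeval_add_of_mem_adjoin_pair hh
      have hP : P = 0 := by
        rw [map_add, map_mul, hx, zero_mul, add_zero] at h0
        have hφ (P : Polynomial k) : constantCoeff (Polynomial.aeval y P) =
            Polynomial.aeval (constantCoeff y) P := by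
          rw [Polynomial.aeval_def, Polynomial.hom_eval₂, Polynomial.aeval_def]
          congr 1
        rw [hφ] at h0
        exact (transcendental_iff.1 hy) P h0
      subst hP
      rw [map_zero, zero_add] at hN ⊢
      obtain ⟨i, h₂, rfl, h₃⟩ := ih h₁ hh₁ fun hd ↦ hN <| by
        rw [pow_succ']; exact mul_dvd_mul (X_dvd_iff.2 hx) hd
      exact ⟨i + 1, h₂, by ring, h₃⟩
    · exact ⟨0, h, by simp, h0, constantCoeff_mem_adjoin hx hh⟩

open PowerSeries in
theorem exists_not_X_pow_dvd {κ : Type*} [Field κ] {h : κ⟦X⟧} (h0 : h ≠ 0) :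
    ∃ N, ¬ (X : κ⟦X⟧) ^ N ∣ h := by
  by_contra! H
  apply h0
  ext n
  exact X_pow_dvd_iff.1 (H (n + 1)) n (Nat.lt_succ_self n)

open PowerSeries in
theorem exponent_lt_of_eq_X_mul {κ : Type*} [Field κ] {x a b c : κ⟦X⟧} {i j : ℕ}
    (ha : constantCoeff a ≠ 0) (hc : constantCoeff c = 0) (hx : x ≠ 0)
    (h : x ^ j * a = c * (x ^ i * b)) : i < j := by
  by_contra! hle
  obtain ⟨e, rfl⟩ := Nat.exists_eq_add_of_le hle
  have : a = c * (x ^ e * b) := by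
    apply mul_left_cancel₀ (pow_ne_zero j hx)
    rw [h]; ring
  apply ha
  rw [this, map_mul, hc, zero_mul]

open PowerSeries in
theorem exponent_le_of_eq_mul {κ : Type*} [Field κ] {x a b c : κ⟦X⟧} {i j : ℕ}
    (ha : constantCoeff a ≠ 0) (hx : constantCoeff x = 0) (hx' : x ≠ 0)
    (h : x ^ j * a = c * (x ^ i * b)) : i ≤ j := by
  by_contra! hlt
  obtain ⟨e, rfl⟩ := Nat.exists_eq_add_of_lt hlt
  have : a = c * (x ^ (e + 1) * b) := by
    apply mul_left_cancel₀ (pow_ne_zero j hx')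
    rw [h]; ring
  apply ha
  rw [this]; simp [hx]

open PowerSeries in
theorem exists_uniformizer {k κ : Type*} [Field k] [Field κ] [Algebra k κ]
    {x y : κ⟦X⟧} (hx : constantCoeff x = 0) (hy : Transcendental k (constantCoeff y)) {Z : κ}
    (hZ : Z ≠ 0)
    (h₁ : ∃ g ∈ Algebra.adjoin k {x, y}, ∃ h ∈ Algebra.adjoin k {x, y}, h ≠ 0 ∧ g = C Z * h)
    (h₂ : ∃ g ∈ Algebra.adjoin k {x, y}, ∃ h ∈ Algebra.adjoin k {x, y}, h ≠ 0 ∧ g = X * h) :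
    Z ∈ IntermediateField.adjoin k {constantCoeff y} ∧
      ∃ x', x = X * x' ∧ constantCoeff x' ≠ 0 := by
  obtain ⟨x', rfl⟩ := X_dvd_iff.2 hx
  have hne {g h c : κ⟦X⟧} (hg : g ∈ Algebra.adjoin k {X * x', y})
      (hh : h ∈ Algebra.adjoin k {X * x', y}) (h0 : h ≠ 0) (hc : c ≠ 0) (hgh : g = c * h) :
      ∃ i j a b, g = (X * x') ^ j * a ∧ h = (X * x') ^ i * b ∧ constantCoeff a ≠ 0 ∧
        constantCoeff b ≠ 0 ∧ constantCoeff a ∈ Algebra.adjoin k {constantCoeff y} ∧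
        constantCoeff b ∈ Algebra.adjoin k {constantCoeff y} := by
    obtain ⟨N, hN⟩ := exists_not_X_pow_dvd h0
    have hg0 : g ≠ 0 := by rw [hgh]; exact mul_ne_zero hc h0
    obtain ⟨M, hM⟩ := exists_not_X_pow_dvd hg0
    obtain ⟨i, b, hb, hb', hb''⟩ := exists_eq_pow_mul_of_mem_adjoin hx hy N h hh hN
    obtain ⟨j, a, ha, ha', ha''⟩ := exists_eq_pow_mul_of_mem_adjoin hx hy M g hg hM
    exact ⟨i, j, a, b, ha, hb, ha', hb', ha'', hb''⟩
  have hx' : constantCoeff x' ≠ 0 := by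
    obtain ⟨g, hg, h, hh, h0, hgh⟩ := h₂
    obtain ⟨i, j, a, b, rfl, rfl, ha, hb, -, -⟩ := hne hg hh h0 X_ne_zero hgh
    rcases eq_or_ne x' 0 with rfl | hx0
    · exfalso
      have hi : i = 0 := by
        by_contra hi
        simp [hi] at h0
      subst hi
      rcases Nat.eq_zero_or_pos j with rfl | hj
      · simp only [pow_zero, one_mul] at hgh
        apply ha
        rw [hgh]; simp
      · have : X * b = 0 := by
          simpa [hj.ne'] using hgh.symm
        rcases mul_eq_zero.1 this with h | h
        · exact X_ne_zero h
        · exact hb (by rw [h]; simp)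
    · have hlt := exponent_lt_of_eq_X_mul ha (by simp) (mul_ne_zero X_ne_zero hx0) hgh
      obtain ⟨e, rfl⟩ := Nat.exists_eq_add_of_lt hlt
      have : b = x' * ((X * x') ^ e * a) := by
        apply mul_left_cancel₀ (pow_ne_zero i (mul_ne_zero X_ne_zero hx0))
        apply mul_left_cancel₀ (X_ne_zero (R := κ))
        rw [← hgh]; ring
      intro h
      apply hb
      rw [this, map_mul, h, zero_mul]
  refine ⟨?_, x', rfl, hx'⟩
  have hx0 : X * x' ≠ 0 := mul_ne_zero X_ne_zero (by rintro rfl; simp at hx')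
  have hCZ : C Z ≠ 0 := by simpa using hZ
  obtain ⟨g, hg, h, hh, h0, hgh⟩ := h₁
  obtain ⟨i, j, a, b, rfl, rfl, ha, hb, hak, hbk⟩ := hne hg hh h0 hCZ hgh
  have h₁ := exponent_le_of_eq_mul ha hx hx0 hgh
  have h₂ : j ≤ i := exponent_le_of_eq_mul (c := C Z⁻¹) (i := j) (b := a) hb hx hx0 <| by
    rw [hgh, ← mul_assoc, ← map_mul, inv_mul_cancel₀ hZ, map_one, one_mul]
  obtain rfl := le_antisymm h₁ h₂
  have : a = C Z * b := by
    apply mul_left_cancel₀ (pow_ne_zero i hx0)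
    rw [hgh]; ring
  have hZe : Z = constantCoeff a / constantCoeff b := by
    rw [this, map_mul, constantCoeff_C, mul_div_cancel_right₀ _ hb]
  rw [hZe]
  have hle := IntermediateField.algebra_adjoin_le_adjoin k {constantCoeff y}
  exact div_mem (hle hak) (hle hbk)

open PowerSeries in
theorem leading_coeff_eq {k κ : Type*} [Field k] [Field κ] [Algebra k κ]
    (hκ : ∀ s : κ, s ∉ (algebraMap k κ).range → Transcendental k s)
    {Z : κ} (hZ : Z ∉ (algebraMap k κ).range) {d : ℕ} (hd : 0 < d) {w t : κ⟦X⟧}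
    (hw : constantCoeff w ≠ 0)
    (h₁ : ∃ g ∈ Algebra.adjoin k {X ^ d * w, t}, ∃ h ∈ Algebra.adjoin k {X ^ d * w, t},
      h ≠ 0 ∧ g = C Z * h)
    (h₂ : ∃ g ∈ Algebra.adjoin k {X ^ d * w, t}, ∃ h ∈ Algebra.adjoin k {X ^ d * w, t},
      h ≠ 0 ∧ g = X * h) :
    ∃ (s r : κ) (c : k) (β : ℕ), s ∉ (algebraMap k κ).range ∧
      Z ∈ IntermediateField.adjoin k {s} ∧ r ≠ 0 ∧ c ≠ 0 ∧
      constantCoeff w = r ^ d * s ^ β * algebraMap k κ c := by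
  obtain ⟨g, hg, h, hh, h0, hgh⟩ := id h₁
  obtain ⟨N, hN⟩ := exists_not_X_pow_dvd h0
  obtain ⟨x, y, u, α, β, c, hx, hF, hu, hc, hle, hy⟩ :=
    blowup (X ^ d * w) hZ N (X ^ d * w) t 1 g h 1 0 1 (by simp [hd.ne']) (by simp) (by simp)
      one_ne_zero hg hh hN hgh
  have hZ0 : Z ≠ 0 := by rintro rfl; exact hZ (zero_mem _)
  have hy0 : constantCoeff y ≠ 0 := fun h ↦ hy (by rw [h]; exact zero_mem _)
  obtain ⟨g', hg', h', hh', h0', hgh'⟩ := h₂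
  obtain ⟨hZs, x', rfl, hx'⟩ := exists_uniformizer hx (hκ _ hy) hZ0
    ⟨g, hle hg, h, hle hh, h0, hgh⟩ ⟨g', hle hg', h', hle hh', h0', hgh'⟩
  have hc' : constantCoeff (x' ^ α * y ^ β * u) ≠ 0 := by
    rw [map_mul, map_mul, map_pow, map_pow, hu]
    exact mul_ne_zero (mul_ne_zero (pow_ne_zero _ hx') (pow_ne_zero _ hy0)) (by simpa using hc)
  have hF' : X ^ d * w = X ^ α * (x' ^ α * y ^ β * u) := by rw [hF]; ring
  have h₁ := exponent_le_of_eq_mul (c := 1) hw constantCoeff_X X_ne_zero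
    (hF'.trans (one_mul _).symm)
  have h₂ := exponent_le_of_eq_mul (c := 1) hc' constantCoeff_X X_ne_zero
    (hF'.symm.trans (one_mul _).symm)
  obtain rfl := le_antisymm h₁ h₂
  refine ⟨constantCoeff y, constantCoeff x', c, β, hy, hZs, hx', hc, ?_⟩
  rw [mul_left_cancel₀ (pow_ne_zero _ X_ne_zero) hF', map_mul, map_mul, map_pow, map_pow, hu]

open Polynomial in
theorem dvd_of_valuation_of_pow_relation {k : Type*} [Field k] {f : k[X] → ℕ}
    (hf : ∀ a b, a ≠ 0 → b ≠ 0 → f (a * b) = f a + f b) {D P Q R S : k[X]} {d β : ℕ} {c : k}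
    (hD : D ≠ 0) (hP : P ≠ 0) (hQ : Q ≠ 0) (hR : R ≠ 0) (hS : S ≠ 0) (hc : c ≠ 0)
    (hfc : f (C c) = 0) (h : D * R ^ d * P ^ β * C c = S ^ d * Q ^ β) (hPQ : f P = f Q) :
    d ∣ f D := by
  have h1 : f 1 = 0 := by simpa using hf 1 1 one_ne_zero one_ne_zero
  have hpow (a : k[X]) (ha : a ≠ 0) (n : ℕ) : f (a ^ n) = n * f a := by
    induction n with
    | zero => simpa using h1
    | succ n ih => rw [pow_succ, hf _ _ (pow_ne_zero _ ha) ha, ih]; ring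
  have h := congrArg f h
  have hRd := pow_ne_zero d hR
  have hPb := pow_ne_zero β hP
  rw [hf _ _ (mul_ne_zero (mul_ne_zero hD hRd) hPb) (by simpa using hc),
    hf _ _ (mul_ne_zero hD hRd) hPb, hf _ _ hD hRd, hf _ _ (pow_ne_zero d hS) (pow_ne_zero β hQ),
    hpow _ hR, hpow _ hS, hpow _ hP, hpow _ hQ, hfc, hPQ] at h
  have : d * f S = f D + d * f R := by omega
  exact (Nat.dvd_add_left (dvd_mul_right d (f R))).1 (this ▸ dvd_mul_right d (f S))

open Polynomial in
theorem dvd_multiplicity_of_pow_relation {k : Type*} [Field k] {π : k[X]} (hπ : Irreducible π)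
    {D P Q R S : k[X]} {d β : ℕ} {c : k}
    (hD : D ≠ 0) (hP : P ≠ 0) (hQ : Q ≠ 0) (hR : R ≠ 0) (hS : S ≠ 0) (hc : c ≠ 0)
    (h : D * R ^ d * P ^ β * C c = S ^ d * Q ^ β) (hπP : ¬ π ∣ P) (hπQ : ¬ π ∣ Q) :
    d ∣ multiplicity π D := by
  refine dvd_of_valuation_of_pow_relation (f := multiplicity π) (fun a b ha hb ↦ ?_)
    hD hP hQ hR hS hc ?_ h ?_
  · exact multiplicity_mul hπ.prime
      (FiniteMultiplicity.of_not_isUnit hπ.not_isUnit (mul_ne_zero ha hb))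
  · exact multiplicity_eq_zero.2 fun hd ↦
      hπ.not_isUnit (isUnit_of_dvd_unit hd (isUnit_C.2 hc.isUnit))
  · rw [multiplicity_eq_zero.2 hπP, multiplicity_eq_zero.2 hπQ]

open Polynomial in
theorem root_and_dvd_of_pow_relation {k : Type*} [Field k] {B P Q R S : k[X]} {A d β : ℕ} {c : k}
    (hB : B.coeff 0 ≠ 0) (hℓ : 0 < B.natDegree) (hℓd : B.natDegree ≤ d)
    (hP1 : P.natDegree ≤ 1) (hQ1 : Q.natDegree ≤ 1)
    (hP : P ≠ 0) (hQ : Q ≠ 0) (hR : R ≠ 0) (hS : S ≠ 0) (hc : c ≠ 0)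
    (h : X ^ A * B * R ^ d * P ^ β * C c = S ^ d * Q ^ β) :
    (∃ r : k, r ≠ 0 ∧ B.eval r = 0) ∧ (d ∣ A ∨ d ∣ A + B.natDegree ∨ B.natDegree = d) := by
  have hB0 : B ≠ 0 := by rintro rfl; simp at hB
  have hXA : (X : k[X]) ^ A ≠ 0 := pow_ne_zero _ X_ne_zero
  have hXB : ¬ X ∣ B := fun h ↦ hB (X_dvd_iff.1 h)
  obtain ⟨π, hπ, hπB⟩ := exists_irreducible_of_natDegree_pos hℓ
  have hπ1 : 0 < π.natDegree := hπ.natDegree_pos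
  have hπX : ¬ π ∣ X := fun hd ↦
    hXB ((hπ.associated_of_dvd irreducible_X hd).symm.dvd.trans hπB)
  have hcop : IsCoprime X π := (irreducible_X.coprime_iff_not_dvd).2 fun hd ↦
    hπX (irreducible_X.associated_of_dvd hπ hd).symm.dvd
  have hfin : FiniteMultiplicity π B := FiniteMultiplicity.of_not_isUnit hπ.not_isUnit hB0
  have he1 : multiplicity π B ≠ 0 := fun h0 ↦ multiplicity_eq_zero.1 h0 hπB
  have hle : multiplicity π B * π.natDegree ≤ B.natDegree := by
    rw [← natDegree_pow]
    exact natDegree_le_of_dvd (pow_multiplicity_dvd π B) hB0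
  have key (h₁ : ¬ π ∣ P) (h₂ : ¬ π ∣ Q) : d ≤ multiplicity π B := by
    have := dvd_multiplicity_of_pow_relation hπ (mul_ne_zero hXA hB0) hP hQ hR hS hc h h₁ h₂
    rw [multiplicity_mul hπ.prime
      (FiniteMultiplicity.of_not_isUnit hπ.not_isUnit (mul_ne_zero hXA hB0)),
      multiplicity_eq_zero.2 fun hd ↦ hπX (hπ.prime.dvd_of_dvd_pow hd), zero_add] at this
    exact Nat.le_of_dvd (Nat.pos_of_ne_zero he1) this
  constructor
  · have hπ_one : π.natDegree = 1 := by
      by_cases h₁ : π ∣ P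
      · have := natDegree_le_of_dvd h₁ hP
        omega
      by_cases h₂ : π ∣ Q
      · have := natDegree_le_of_dvd h₂ hQ
        omega
      have := key h₁ h₂
      nlinarith
    obtain ⟨r, hr⟩ := exists_root_of_degree_eq_one
      ((degree_eq_iff_natDegree_eq_of_pos one_pos).2 hπ_one)
    refine ⟨r, ?_, eval_eq_zero_of_dvd_of_eval_eq_zero hπB hr⟩
    rintro rfl
    have := eval_eq_zero_of_dvd_of_eval_eq_zero hπB hr
    exact hB (by rwa [coeff_zero_eq_eval_zero])
  · by_contra! H
    obtain ⟨hA, hA', hℓ'⟩ := H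
    have hlt : B.natDegree < d := lt_of_le_of_ne hℓd hℓ'
    have h₁ : π ∣ P ∨ π ∣ Q := by
      by_contra! H
      have := key H.1 H.2
      nlinarith
    have h₂ : X ∣ P ∨ X ∣ Q := by
      by_contra! H
      refine hA ?_
      have := dvd_multiplicity_of_pow_relation irreducible_X (mul_ne_zero hXA hB0) hP hQ hR hS hc h
        H.1 H.2
      rwa [multiplicity_mul prime_X
        (FiniteMultiplicity.of_not_isUnit irreducible_X.not_isUnit (mul_ne_zero hXA hB0)),
        multiplicity_eq_zero.2 hXB, add_zero,
        multiplicity_pow_self_of_prime prime_X] at this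
    have hno {T : k[X]} (hT : T ≠ 0) (hT1 : T.natDegree ≤ 1) (h₁ : π ∣ T) (h₂ : X ∣ T) : False := by
      have := natDegree_le_of_dvd (hcop.mul_dvd h₂ h₁) hT
      rw [natDegree_mul X_ne_zero hπ.ne_zero, natDegree_X] at this
      omega
    have hPQ : P.natDegree = Q.natDegree := by
      rcases h₁ with h₁ | h₁ <;> rcases h₂ with h₂ | h₂
      · exact (hno hP hP1 h₁ h₂).elim
      · have e₁ := natDegree_le_of_dvd h₁ hP
        have e₂ := natDegree_le_of_dvd h₂ hQ
        rw [natDegree_X] at e₂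
        omega
      · have e₁ := natDegree_le_of_dvd h₁ hQ
        have e₂ := natDegree_le_of_dvd h₂ hP
        rw [natDegree_X] at e₂
        omega
      · exact (hno hQ hQ1 h₁ h₂).elim
    refine hA' ?_
    have := dvd_of_valuation_of_pow_relation (f := natDegree) (fun a b ha hb ↦ natDegree_mul ha hb)
      (mul_ne_zero hXA hB0) hP hQ hR hS hc (natDegree_C c) h hPQ
    rwa [natDegree_mul hXA hB0, natDegree_X_pow] at this

theorem RatFunc.natDegree_le_one_of_X_mem_adjoin {k : Type*} [Field k] {s : RatFunc k}
    (hs : RatFunc.X ∈ IntermediateField.adjoin k {s}) :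
    s.num.natDegree ≤ 1 ∧ s.denom.natDegree ≤ 1 := by
  have htop : IntermediateField.adjoin k {s} = ⊤ := by
    rw [eq_top_iff, ← RatFunc.adjoin_X]
    exact IntermediateField.adjoin_le_iff.2 (by simpa using hs)
  have := RatFunc.finrank_eq_max_natDegree s
  rw [htop, IntermediateField.finrank_top] at this
  omega

open Polynomial in
theorem root_and_dvd_of_ratFunc {k : Type*} [Field k] {B : k[X]} {A d β : ℕ} {c : k}
    {s r : RatFunc k} (hB : B.coeff 0 ≠ 0) (hℓ : 0 < B.natDegree) (hℓd : B.natDegree ≤ d)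
    (hs : s ∉ (algebraMap k (RatFunc k)).range)
    (hs' : RatFunc.X ∈ IntermediateField.adjoin k {s}) (hr : r ≠ 0) (hc : c ≠ 0)
    (h : (algebraMap k[X] (RatFunc k) (X ^ A * B))⁻¹ =
      r ^ d * s ^ β * algebraMap k (RatFunc k) c) :
    (∃ r : k, r ≠ 0 ∧ B.eval r = 0) ∧ (d ∣ A ∨ d ∣ A + B.natDegree ∨ B.natDegree = d) := by
  obtain ⟨hP1, hQ1⟩ := RatFunc.natDegree_le_one_of_X_mem_adjoin hs'
  have hs0 : s ≠ 0 := by rintro rfl; exact hs (zero_mem _)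
  refine root_and_dvd_of_pow_relation (β := β) (c := c) (R := r.num) (S := r.denom) hB hℓ hℓd
    hP1 hQ1 (RatFunc.num_ne_zero hs0) s.denom_ne_zero (RatFunc.num_ne_zero hr) r.denom_ne_zero
    hc ?_
  have hinj := IsFractionRing.injective k[X] (RatFunc k)
  apply hinj
  have hB0 : X ^ A * B ≠ 0 := mul_ne_zero (pow_ne_zero _ X_ne_zero) (by rintro rfl; simp at hB)
  have hB0' : algebraMap k[X] (RatFunc k) (X ^ A * B) ≠ 0 := by
    rwa [ne_eq, map_eq_zero_iff _ hinj]
  have hsd : algebraMap k[X] (RatFunc k) s.denom ≠ 0 := by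
    rw [ne_eq, map_eq_zero_iff _ hinj]; exact s.denom_ne_zero
  have hrd : algebraMap k[X] (RatFunc k) r.denom ≠ 0 := by
    rw [ne_eq, map_eq_zero_iff _ hinj]; exact r.denom_ne_zero
  have hCc : algebraMap k[X] (RatFunc k) (C c) = algebraMap k (RatFunc k) c := by
    rw [IsScalarTower.algebraMap_apply k k[X] (RatFunc k)]; rfl
  rw [← RatFunc.num_div_denom s, ← RatFunc.num_div_denom r] at h
  rw [map_mul _ _ (C c), map_mul _ _ (_ ^ β), map_mul _ _ (_ ^ d), map_mul _ (_ ^ d) (_ ^ β), hCc]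
  simp only [map_pow]
  rw [div_pow, div_pow] at h
  field_simp at h
  exact h.symm

/-- The leading form of `G` for the weights `p, q`, restricted to degree `e`, with each monomial
`m` replaced by the power `a * m 0 + b * m 1` of a single variable. -/
noncomputable def edgePoly {k : Type*} [Field k] (a b p q e : ℕ) (G : MvPolynomial (Fin 2) k) :
    Polynomial k :=
  ∑ m ∈ G.support with p * m 0 + q * m 1 = e,
    Polynomial.C (G.coeff m) * Polynomial.X ^ (a * m 0 + b * m 1)

theorem eq_of_edge {a b p q : ℕ} (hab : a * q = b * p + 1) {i j i' j' : ℕ}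
    (h₁ : p * i + q * j = p * i' + q * j') (h₂ : a * i + b * j = a * i' + b * j') :
    i = i' ∧ j = j' := by
  zify at *
  constructor
  · linear_combination q * h₂ - b * h₁ - (i - i') * hab
  · linear_combination a * h₁ - p * h₂ - (j - j') * hab

theorem edgePoly_coeff {k : Type*} [Field k] {a b p q e : ℕ} (hab : a * q = b * p + 1)
    {G : MvPolynomial (Fin 2) k} (m : Fin 2 →₀ ℕ) (hm : p * m 0 + q * m 1 = e) :
    (edgePoly a b p q e G).coeff (a * m 0 + b * m 1) = G.coeff m := by
  rw [edgePoly, Polynomial.finsetSum_coeff, Finset.sum_eq_single m]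
  · simp
  · intro m' hm' hne
    rw [Polynomial.coeff_C_mul, Polynomial.coeff_X_pow, if_neg, mul_zero]
    intro h
    obtain ⟨h₁, h₂⟩ := eq_of_edge hab ((Finset.mem_filter.1 hm').2.trans hm.symm) h.symm
    exact hne (by ext i; fin_cases i <;> assumption)
  · intro h
    have : G.coeff m = 0 := by
      by_contra h0
      exact h (Finset.mem_filter.2 ⟨MvPolynomial.mem_support_iff.2 h0, hm⟩)
    simp [this]

theorem exists_of_edgePoly_coeff_ne_zero {k : Type*} [Field k] {a b p q e j : ℕ}
    {G : MvPolynomial (Fin 2) k} (h : (edgePoly a b p q e G).coeff j ≠ 0) :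
    ∃ m ∈ G.support, p * m 0 + q * m 1 = e ∧ a * m 0 + b * m 1 = j := by
  rw [edgePoly, Polynomial.finsetSum_coeff] at h
  obtain ⟨m, hm, hne⟩ := Finset.exists_ne_zero_of_sum_ne_zero h
  rw [Finset.mem_filter] at hm
  refine ⟨m, hm.1, hm.2, ?_⟩
  by_contra hj
  exact hne (by rw [Polynomial.coeff_C_mul, Polynomial.coeff_X_pow, if_neg (Ne.symm hj), mul_zero])

open PowerSeries in
theorem exists_lift_aeval_edge {k M : Type*} [Field k] [Field M] [Algebra (RatFunc k)⟦X⟧ M]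
    [IsFractionRing (RatFunc k)⟦X⟧ M] [Algebra k M] [IsScalarTower k (RatFunc k)⟦X⟧ M]
    {a b p q : ℕ} {x y : M}
    (hx : x = algebraMap _ M (C (RatFunc.X (K := k))) ^ a * (algebraMap (RatFunc k)⟦X⟧ M X ^ p)⁻¹)
    (hy : y = algebraMap _ M (C (RatFunc.X (K := k))) ^ b * (algebraMap (RatFunc k)⟦X⟧ M X ^ q)⁻¹)
    {G : MvPolynomial (Fin 2) k} {e : ℕ} (he : ∀ m ∈ G.support, p * m 0 + q * m 1 ≤ e) :
    ∃ H : (RatFunc k)⟦X⟧,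
      algebraMap (RatFunc k)⟦X⟧ M X ^ e * MvPolynomial.aeval ![x, y] G = algebraMap _ M H ∧
      constantCoeff H = algebraMap (Polynomial k) (RatFunc k) (edgePoly a b p q e G) := by
  refine ⟨∑ m ∈ G.support, C (algebraMap k (RatFunc k) (G.coeff m) *
    RatFunc.X ^ (a * m 0 + b * m 1)) * X ^ (e - (p * m 0 + q * m 1)), ?_, ?_⟩
  · have hX : algebraMap (RatFunc k)⟦X⟧ M X ≠ 0 := by
      rw [ne_eq, map_eq_zero_iff _ (IsFractionRing.injective _ M)]
      exact X_ne_zero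
    rw [MvPolynomial.aeval_def, MvPolynomial.eval₂_eq', Finset.mul_sum, map_sum]
    refine Finset.sum_congr rfl fun m hm ↦ ?_
    obtain ⟨e', he'⟩ := Nat.exists_eq_add_of_le (he m hm)
    have hc : algebraMap k M (G.coeff m) =
        algebraMap _ M (C (algebraMap k (RatFunc k) (G.coeff m))) := by
      rw [IsScalarTower.algebraMap_apply k (RatFunc k)⟦X⟧ M,
        IsScalarTower.algebraMap_apply k (RatFunc k) (RatFunc k)⟦X⟧]
      rfl
    rw [Fin.prod_univ_two, he', Nat.add_sub_cancel_left, hc]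
    simp only [Matrix.cons_val_zero, Matrix.cons_val_one, map_mul, map_pow, hx, hy]
    have hp := pow_ne_zero p hX
    have hq := pow_ne_zero q hX
    rw [pow_add, pow_add, pow_mul _ p, pow_mul _ q, pow_add, pow_mul _ a, pow_mul _ b]
    generalize algebraMap (RatFunc k)⟦X⟧ M X ^ p = u at *
    generalize algebraMap (RatFunc k)⟦X⟧ M X ^ q = v at *
    rw [mul_pow, mul_pow, inv_pow, inv_pow]
    field_simp
  · rw [edgePoly, map_sum, map_sum, Finset.sum_filter]
    refine Finset.sum_congr rfl fun m hm ↦ ?_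
    split_ifs with h
    · rw [h]
      simp [RatFunc.algebraMap_X]
    · have := he m hm
      simp only [map_mul, map_pow, constantCoeff_X, constantCoeff_C]
      rw [zero_pow (by omega), mul_zero]

open PowerSeries in
theorem aeval_edge_injective {k M : Type*} [Field k] [Field M] [Algebra (RatFunc k)⟦X⟧ M]
    [IsFractionRing (RatFunc k)⟦X⟧ M] [Algebra k M] [IsScalarTower k (RatFunc k)⟦X⟧ M]
    {a b p q : ℕ} (hab : a * q = b * p + 1) {x y : M}
    (hx : x = algebraMap _ M (C (RatFunc.X (K := k))) ^ a * (algebraMap (RatFunc k)⟦X⟧ M X ^ p)⁻¹)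
    (hy : y = algebraMap _ M (C (RatFunc.X (K := k))) ^ b * (algebraMap (RatFunc k)⟦X⟧ M X ^ q)⁻¹) :
    Function.Injective (MvPolynomial.aeval (R := k) ![x, y]) := by
  rw [injective_iff_map_eq_zero]
  intro G hG
  by_contra h0
  obtain ⟨m, hm, hmax⟩ := G.support.exists_max_image (fun m ↦ p * m 0 + q * m 1)
    (MvPolynomial.support_nonempty.2 h0)
  obtain ⟨H, hH, hH'⟩ := exists_lift_aeval_edge hx hy hmax
  rw [hG, mul_zero] at hH
  have hH0 := (map_eq_zero_iff _ (IsFractionRing.injective _ M)).1 hH.symm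
  rw [hH0, map_zero] at hH'
  have h1 := (map_eq_zero_iff _ (IsFractionRing.injective (Polynomial k) (RatFunc k))).1 hH'.symm
  have := edgePoly_coeff hab m rfl (G := G)
  rw [h1] at this
  exact MvPolynomial.mem_support_iff.1 hm (by simpa using this.symm)

theorem monomial_quotient_left {M : Type*} [Field M] {z t : M} (hz : z ≠ 0) (ht : t ≠ 0)
    {a b p q : ℕ} (hab : a * q = b * p + 1) :
    (z ^ a * (t ^ p)⁻¹) ^ q * ((z ^ b * (t ^ q)⁻¹) ^ p)⁻¹ = z := by
  have h₁ : (z ^ a) ^ q = (z ^ b) ^ p * z := by rw [← pow_mul, hab, pow_succ, pow_mul]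
  have h₂ : (t ^ q) ^ p = (t ^ p) ^ q := by rw [← pow_mul, ← pow_mul, mul_comm]
  rw [mul_pow, mul_pow, inv_pow, inv_pow, h₁, h₂]
  generalize (z ^ b) ^ p = u at *
  have hu : u ≠ 0 := by rintro rfl; simp [hz] at h₁
  have := pow_ne_zero q (pow_ne_zero p ht)
  generalize (t ^ p) ^ q = v at *
  field_simp

theorem monomial_quotient_right {M : Type*} [Field M] {z t : M} (hz : z ≠ 0) (ht : t ≠ 0)
    {a b p q : ℕ} (hab : a * q = b * p + 1) :
    (z ^ a * (t ^ p)⁻¹) ^ b * ((z ^ b * (t ^ q)⁻¹) ^ a)⁻¹ = t := by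
  have h₁ : (t ^ q) ^ a = (t ^ p) ^ b * t := by
    rw [← pow_mul, mul_comm, hab, pow_succ, mul_comm b, pow_mul]
  have h₂ : (z ^ a) ^ b = (z ^ b) ^ a := by rw [← pow_mul, ← pow_mul, mul_comm]
  rw [mul_pow, mul_pow, inv_pow, inv_pow, h₁, h₂]
  have hu := pow_ne_zero a (pow_ne_zero b hz)
  generalize (z ^ b) ^ a = u at *
  have := pow_ne_zero b (pow_ne_zero p ht)
  generalize (t ^ p) ^ b = v at *
  field_simp

open PowerSeries in
theorem exists_mem_adjoin_of_mem_adjoin_map {k R M : Type*} [Field k] [CommRing R] [Nontrivial R]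
    [Field M] [Algebra k R] [Algebra R M] [Algebra k M] [IsScalarTower k R M]
    (hinj : Function.Injective (algebraMap R M)) {x t z : R}
    (hz : algebraMap R M z ∈ IntermediateField.adjoin k {algebraMap R M x, algebraMap R M t}) :
    ∃ g ∈ Algebra.adjoin k {x, t}, ∃ h ∈ Algebra.adjoin k {x, t}, h ≠ 0 ∧ g = z * h := by
  obtain ⟨u, hu, v, hv, huv⟩ := IntermediateField.mem_adjoin_iff_div.1 hz
  have hmap : Algebra.adjoin k {algebraMap R M x, algebraMap R M t} =
      (Algebra.adjoin k {x, t}).map (IsScalarTower.toAlgHom k R M) := by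
    rw [AlgHom.map_adjoin, Set.image_pair]
    rfl
  rw [hmap] at hu hv
  obtain ⟨g, hg, rfl⟩ := hu
  obtain ⟨h, hh, rfl⟩ := hv
  by_cases h0 : h = 0
  · refine ⟨0, zero_mem _, 1, one_mem _, one_ne_zero, ?_⟩
    subst h0
    rw [map_zero, div_zero, map_eq_zero_iff _ hinj] at huv
    rw [huv, zero_mul]
  · refine ⟨g, hg, h, hh, h0, ?_⟩
    apply hinj
    have : algebraMap R M h ≠ 0 := by rwa [ne_eq, map_eq_zero_iff _ hinj]
    rw [map_mul, huv]
    exact (div_mul_cancel₀ _ this).symm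

open PowerSeries in
theorem root_and_dvd_of_adjoin_eq_top {k L : Type*} [Field k] [Field L]
    [Algebra (MvPolynomial (Fin 2) k) L] [IsFractionRing (MvPolynomial (Fin 2) k) L]
    [Algebra k L] [IsScalarTower k (MvPolynomial (Fin 2) k) L]
    (φ : MvPolynomial (Fin 2) k ≃ₐ[k] MvPolynomial (Fin 2) k) {G : MvPolynomial (Fin 2) k}
    {g : L} (hg : IntermediateField.adjoin k {algebraMap _ L (φ G), g} = ⊤)
    {a b p q d A : ℕ} (hab : a * q = b * p + 1) (hd : 0 < d)
    (he : ∀ m ∈ G.support, p * m 0 + q * m 1 ≤ d) {B : Polynomial k}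
    (hGB : edgePoly a b p q d G = Polynomial.X ^ A * B)
    (hB : B.coeff 0 ≠ 0) (hℓ : 0 < B.natDegree) (hℓd : B.natDegree ≤ d) :
    (∃ r : k, r ≠ 0 ∧ B.eval r = 0) ∧ (d ∣ A ∨ d ∣ A + B.natDegree ∨ B.natDegree = d) := by
  let M := FractionRing (RatFunc k)⟦X⟧
  let ι : (RatFunc k)⟦X⟧ →+* M := algebraMap _ _
  have hι : Function.Injective ι := IsFractionRing.injective _ M
  obtain ⟨x, hx⟩ : ∃ x : M, x = ι (C (RatFunc.X (K := k))) ^ a * (ι X ^ p)⁻¹ := ⟨_, rfl⟩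
  obtain ⟨y, hy⟩ : ∃ y : M, y = ι (C (RatFunc.X (K := k))) ^ b * (ι X ^ q)⁻¹ := ⟨_, rfl⟩
  have hinj : Function.Injective
      ((MvPolynomial.aeval (R := k) ![x, y]).comp φ.symm.toAlgHom) :=
    (aeval_edge_injective hab hx hy).comp φ.symm.injective
  let ψ : L →ₐ[k] M := IsFractionRing.liftAlgHom hinj
  have hψ (P) : ψ (algebraMap _ L (φ P)) = MvPolynomial.aeval ![x, y] P := by
    have : ψ (algebraMap _ L (φ P)) = _ := IsFractionRing.lift_algebraMap hinj (φ P)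
    rw [this]
    simp
  have hZ0 : ι (C (RatFunc.X (K := k))) ≠ 0 := by
    rw [ne_eq, map_eq_zero_iff _ hι]
    simp [RatFunc.X_ne_zero]
  have hX0 : ι X ≠ 0 := by
    rw [ne_eq, map_eq_zero_iff _ hι]
    exact X_ne_zero
  obtain ⟨H, hH, hHc⟩ := exists_lift_aeval_edge hx hy he
  rw [← hψ, hGB] at *
  have hB0 : Polynomial.X ^ A * B ≠ 0 :=
    mul_ne_zero (pow_ne_zero _ Polynomial.X_ne_zero) (by rintro rfl; simp at hB)
  have hHc0 : constantCoeff H ≠ 0 := by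
    rwa [hHc, ne_eq, map_eq_zero_iff _ (IsFractionRing.injective (Polynomial k) (RatFunc k))]
  have hHinv : H * H⁻¹ = 1 := PowerSeries.mul_inv_cancel H hHc0
  have hx₀ : ι (X ^ d * H⁻¹) = (ψ (algebraMap _ L (φ G)))⁻¹ := by
    apply eq_inv_of_mul_eq_one_left
    rw [map_mul, map_pow, mul_right_comm, hH, ← map_mul, hHinv, map_one]
  obtain ⟨t, ht⟩ : ∃ t, ι t = ψ g ∨ ι t = (ψ g)⁻¹ := by
    rcases ValuationRing.isInteger_or_isInteger (RatFunc k)⟦X⟧ (ψ g) with ⟨t, ht⟩ | ⟨t, ht⟩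
    · exact ⟨t, Or.inl ht⟩
    · exact ⟨t, Or.inr ht⟩
  have hle : ψ.fieldRange ≤ IntermediateField.adjoin k {ι (X ^ d * H⁻¹), ι t} := by
    rw [AlgHom.fieldRange_eq_map, ← hg, IntermediateField.adjoin_map, Set.image_pair,
      IntermediateField.adjoin_le_iff]
    have h₁ : ι (X ^ d * H⁻¹) ∈ IntermediateField.adjoin k {ι (X ^ d * H⁻¹), ι t} :=
      IntermediateField.subset_adjoin _ _ (by simp)
    have h₂ : ι t ∈ IntermediateField.adjoin k {ι (X ^ d * H⁻¹), ι t} :=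
      IntermediateField.subset_adjoin _ _ (by simp)
    rintro z (rfl | rfl)
    · rw [← inv_inv (ψ (algebraMap _ L (φ G))), ← hx₀]
      exact inv_mem h₁
    · rcases ht with ht | ht
      · rw [← ht]; exact h₂
      · rw [← inv_inv (ψ g), ← ht]; exact inv_mem h₂
  have hXm : x ∈ ψ.fieldRange := ⟨algebraMap _ L (φ (MvPolynomial.X 0)), by
    have := hψ (MvPolynomial.X 0)
    simpa using this⟩
  have hYm : y ∈ ψ.fieldRange := ⟨algebraMap _ L (φ (MvPolynomial.X 1)), by
    have := hψ (MvPolynomial.X 1)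
    simpa using this⟩
  have hZm : ι (C RatFunc.X) ∈ ψ.fieldRange := by
    have : ι (C RatFunc.X) = x ^ q * (y ^ p)⁻¹ := by
      rw [hx, hy, monomial_quotient_left hZ0 hX0 hab]
    rw [this]
    exact mul_mem (pow_mem hXm _) (inv_mem (pow_mem hYm _))
  have hTm : ι X ∈ ψ.fieldRange := by
    have : ι X = x ^ b * (y ^ a)⁻¹ := by
      rw [hx, hy, monomial_quotient_right hZ0 hX0 hab]
    rw [this]
    exact mul_mem (pow_mem hXm _) (inv_mem (pow_mem hYm _))
  have hw : constantCoeff H⁻¹ ≠ 0 := by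
    rw [constantCoeff_inv]; exact inv_ne_zero hHc0
  have hrange (s : RatFunc k) (hs : s ∉ (algebraMap k (RatFunc k)).range) : Transcendental k s :=
    RatFunc.transcendental_of_ne_C s fun ⟨c, hc⟩ ↦ hs ⟨c, hc.symm⟩
  have hXr : (RatFunc.X : RatFunc k) ∉ (algebraMap k (RatFunc k)).range := by
    rintro ⟨c, hc⟩
    have : (Polynomial.C c : Polynomial k) = Polynomial.X := by
      apply IsFractionRing.injective (Polynomial k) (RatFunc k)
      rw [RatFunc.algebraMap_X, ← hc]
      simp
    simpa using congrArg Polynomial.natDegree this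
  obtain ⟨s, r, c, β, hs, hZs, hr, hc, hv⟩ := leading_coeff_eq hrange hXr hd hw
    (exists_mem_adjoin_of_mem_adjoin_map hι (hle hZm))
    (exists_mem_adjoin_of_mem_adjoin_map hι (hle hTm))
  rw [constantCoeff_inv, hHc] at hv
  exact root_and_dvd_of_ratFunc hB hℓ hℓd hs hZs hr hc hv

theorem exists_bezout_nat {p q : ℕ} (hp : 0 < p) (hq : 0 < q) (h : Nat.Coprime p q) :
    ∃ a b : ℕ, a * q = b * p + 1 := by
  obtain ⟨N, h₁, h₂⟩ := Nat.chineseRemainder h 1 0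
  have h₁' : N + p * q ≡ 1 [MOD p] := by simpa [Nat.ModEq] using h₁
  have h₂' : q ∣ N + p * q := dvd_add ((Nat.modEq_zero_iff_dvd).1 h₂) (dvd_mul_left _ _)
  have hpos : 1 ≤ N + p * q := by have := Nat.mul_pos hp hq; omega
  obtain ⟨b, hb⟩ := (Nat.modEq_iff_dvd' hpos).1 h₁'.symm
  obtain ⟨a, ha⟩ := h₂'
  refine ⟨a, b, ?_⟩
  rw [mul_comm a, mul_comm b, ← ha, ← hb]
  omega

theorem exists_edge {S : Finset (Fin 2 →₀ ℕ)} {m n : ℕ} (hS : ∀ z ∈ S, z 0 ≤ m ∧ z 1 ≤ n)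
    (hm : ∃ z ∈ S, z 0 = m) (hn : ∃ z ∈ S, z 1 = n) (hmn : ∀ z ∈ S, ¬ (z 0 = m ∧ z 1 = n)) :
    ∃ p q : ℕ, 0 < p ∧ 0 < q ∧ p.Coprime q ∧ ∃ u ∈ S, ∃ w ∈ S, u ≠ w ∧
      p * w 0 + q * w 1 = p * u 0 + q * u 1 ∧ u 1 = n ∧
      ∀ z ∈ S, p * z 0 + q * z 1 ≤ p * u 0 + q * u 1 := by
  obtain ⟨v, hv, hvm⟩ := hm
  obtain ⟨u₀, hu₀, hu₀n⟩ := hn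
  obtain ⟨u, hu, humax⟩ := (S.filter (fun z ↦ z 1 = n)).exists_max_image (fun z ↦ z 0)
    ⟨u₀, Finset.mem_filter.2 ⟨hu₀, hu₀n⟩⟩
  obtain ⟨huS, hun⟩ := Finset.mem_filter.1 hu
  have hum : u 0 < m := lt_of_le_of_ne (hS u huS).1 fun h ↦ hmn u huS ⟨h, hun⟩
  obtain ⟨w, hw, hwmax⟩ := (S.filter (fun z ↦ u 0 < z 0)).exists_max_image
    (fun z ↦ ((z 0 : ℚ) - u 0) / (n - z 1)) ⟨v, Finset.mem_filter.2 ⟨hv, by omega⟩⟩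
  obtain ⟨hwS, huw⟩ := Finset.mem_filter.1 hw
  have hlt (z) (hz : z ∈ S) (huz : u 0 < z 0) : z 1 < n := by
    refine lt_of_le_of_ne (hS z hz).2 fun h ↦ ?_
    have := humax z (Finset.mem_filter.2 ⟨hz, h⟩)
    omega
  have hwn := hlt w hwS huw
  obtain ⟨e, he⟩ := Nat.exists_eq_add_of_lt huw
  obtain ⟨f, hf⟩ := Nat.exists_eq_add_of_lt hwn
  obtain ⟨g, q, p, hg, hpq, hq, hp⟩ := Nat.exists_coprime' (m := e + 1) (n := f + 1)
    (Nat.gcd_pos_of_pos_left _ (Nat.succ_pos e))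
  have hq0 : 0 < q := Nat.pos_of_ne_zero fun h ↦ by simp [h] at hq
  have hp0 : 0 < p := Nat.pos_of_ne_zero fun h ↦ by simp [h] at hp
  have hw0 : w 0 = u 0 + q * g := by omega
  have hw1 : n = w 1 + p * g := by omega
  refine ⟨p, q, hp0, hq0, hpq.symm, u, huS, w, hwS, fun h ↦ ?_, ?_, hun, fun z hz ↦ ?_⟩
  · rw [h] at huw; exact huw.false
  · rw [hw0, hun, hw1]; ring
  · rw [hun]
    rcases le_or_gt (z 0) (u 0) with hle | hgt
    · exact add_le_add (Nat.mul_le_mul_left _ hle) (Nat.mul_le_mul_left _ (hS z hz).2)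
    · have h := hwmax z (Finset.mem_filter.2 ⟨hz, hgt⟩)
      have hz1 : (0 : ℚ) < n - z 1 := by
        have := hlt z hz hgt
        rw [sub_pos]; exact_mod_cast this
      have hp' : (0 : ℚ) < p := by exact_mod_cast hp0
      have hg' : (0 : ℚ) < g := by exact_mod_cast hg
      have e₁ : (w 0 : ℚ) - u 0 = q * g := by rw [hw0]; push_cast; ring
      have e₂ : (n : ℚ) - w 1 = p * g := by
        have : (n : ℚ) = w 1 + p * g := by exact_mod_cast hw1
        rw [this]; ring
      rw [e₁, e₂, mul_div_mul_right _ _ hg'.ne', div_le_div_iff₀ hz1 hp'] at h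
      have : (p : ℚ) * z 0 + q * z 1 ≤ p * u 0 + q * n := by linarith
      exact_mod_cast this

open Polynomial in
theorem exists_eq_X_pow_mul {k : Type*} [Field k] {P : k[X]} {i j : ℕ} (hi : P.coeff i ≠ 0)
    (hj : P.coeff j ≠ 0) (hij : i ≠ j) : ∃ A, ∃ B : k[X], P = X ^ A * B ∧ B.coeff 0 ≠ 0 ∧
      0 < B.natDegree ∧ P.coeff A ≠ 0 ∧ P.coeff (A + B.natDegree) ≠ 0 := by
  have hP : P ≠ 0 := by rintro rfl; simp at hi
  obtain ⟨B, hB⟩ := (X_pow_dvd_iff (f := P) (n := P.natTrailingDegree)).2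
    fun d hd ↦ coeff_eq_zero_of_lt_natTrailingDegree hd
  have hB0 : B ≠ 0 := by rintro rfl; exact hP (by simpa using hB)
  have hcoeff (l : ℕ) : P.coeff (P.natTrailingDegree + l) = B.coeff l := by
    refine (congrArg (coeff · (P.natTrailingDegree + l)) hB).trans ?_
    rw [add_comm, coeff_X_pow_mul]
  have hA : P.coeff P.natTrailingDegree ≠ 0 := trailingCoeff_nonzero_iff_nonzero.2 hP
  refine ⟨P.natTrailingDegree, B, hB, ?_, ?_, hA, ?_⟩
  · rw [← hcoeff]; simpa using hA
  · by_contra h0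
    have hdeg : P.natDegree = P.natTrailingDegree := by
      have := congrArg natDegree hB
      rw [natDegree_mul (pow_ne_zero _ X_ne_zero) hB0, natDegree_X_pow] at this
      omega
    have h₁ := natTrailingDegree_le_of_ne_zero hi
    have h₂ := natTrailingDegree_le_of_ne_zero hj
    have h₃ := le_natDegree_of_ne_zero hi
    have h₄ := le_natDegree_of_ne_zero hj
    omega
  · rw [hcoeff]; exact leadingCoeff_ne_zero.2 hB0

theorem extremal_of_dvd {a b p q d i j : ℕ} (hp : 0 < p) (hq : 0 < q)
    (hab : a * q = b * p + 1) (hd : 0 < d) (h : p * i + q * j = d) (hdvd : d ∣ a * i + b * j) :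
    (q = 1 ∧ i = 0 ∧ j = d) ∨ (p = 1 ∧ i = d ∧ j = 0) := by
  have hi : d ∣ i := by
    have : i + b * d = q * (a * i + b * j) := by
      rw [← h]; zify at hab ⊢; linear_combination (-(i : ℤ)) * hab
    exact (Nat.dvd_add_left (dvd_mul_left d b)).1 (this ▸ hdvd.mul_left q)
  have hj : d ∣ j := by
    have : j + p * (a * i + b * j) = a * d := by
      rw [← h]; zify at hab ⊢; linear_combination (-(j : ℤ)) * hab
    exact (Nat.dvd_add_left (hdvd.mul_left p)).1 (this ▸ dvd_mul_left d a)
  obtain ⟨x, rfl⟩ := hi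
  obtain ⟨y, rfl⟩ := hj
  have h1 : p * x + q * y = 1 := by
    apply Nat.eq_of_mul_eq_mul_left hd
    linear_combination h
  rcases Nat.eq_zero_or_pos x with rfl | hx
  · left
    rw [mul_zero, zero_add] at h1
    obtain ⟨rfl, rfl⟩ := mul_eq_one.1 h1
    simp
  · rcases Nat.eq_zero_or_pos y with rfl | hy
    · right
      rw [mul_zero, add_zero] at h1
      obtain ⟨rfl, rfl⟩ := mul_eq_one.1 h1
      simp
    · exfalso
      have := Nat.mul_pos hp hx
      have := Nat.mul_pos hq hy
      omega

theorem natDegree_edge_le {a b p q d i j i' j' l : ℕ} (hp : 0 < p) (hq : 0 < q)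
    (hab : a * q = b * p + 1) (h : p * i + q * j = d) (h' : p * i' + q * j' = d)
    (hl : a * i' + b * j' = a * i + b * j + l) :
    l ≤ d ∧ (l = d → d = 0 ∨ (p = 1 ∧ i' = d ∧ j' = 0)) := by
  have hi : i' = i + q * l := by
    zify at *
    linear_combination q * hl + b * h - b * h' - (i' - i) * hab
  have hj : j = j' + p * l := by
    zify at *
    linear_combination (p : ℤ) * hl + a * h - a * h' - (j - j') * hab
  have h₁ : l ≤ q * l := Nat.le_mul_of_pos_left _ hq
  have h₂ : i' ≤ p * i' := Nat.le_mul_of_pos_left _ hp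
  refine ⟨by omega, ?_⟩
  rintro rfl
  by_cases hl0 : l = 0
  · exact Or.inl hl0
  have hi' : i' = l := by omega
  have hj' : q * j' = 0 := by omega
  refine Or.inr ⟨?_, hi', (Nat.mul_eq_zero.1 hj').resolve_left hq.ne'⟩
  have : p * l = 1 * l := by rw [hi'] at h₂ h'; omega
  exact Nat.eq_of_mul_eq_mul_right (Nat.pos_of_ne_zero hl0) this

open MvPolynomial in
theorem exists_elementary {k : Type*} [Field k] {i j : Fin 2} (hij : i ≠ j) (c : k) (r : ℕ) :
    ∃ e : MvPolynomial (Fin 2) k ≃ₐ[k] MvPolynomial (Fin 2) k,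
      e (X i) = X i + C c * X j ^ r ∧ e (X j) = X j := by
  have key (c : k) : (aeval (R := k) (Function.update X i (X i + C c * X j ^ r))).comp
      (aeval (R := k) (Function.update X i (X i + C (-c) * X j ^ r))) =
      AlgHom.id k (MvPolynomial (Fin 2) k) := by
    ext1 l
    rcases eq_or_ne l i with rfl | hl
    · simp [Function.update_of_ne hij.symm]
    · simp [Function.update_of_ne hl]
  refine ⟨AlgEquiv.ofAlgHom (aeval (Function.update X i (X i + C c * X j ^ r)))
    (aeval (Function.update X i (X i + C (-c) * X j ^ r))) (key c) (by simpa using key (-c)),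
    ?_, ?_⟩
  · simp
  · simp [Function.update_of_ne hij.symm]

open MvPolynomial in
theorem degreeOf_add_mul_pow_le {k σ : Type*} [Field k] {i j : σ} (hij : i ≠ j) (c : k) (r s : ℕ) :
    degreeOf i ((X i + C c * X j ^ r) ^ s) ≤ s ∧
      degreeOf j ((X i + C c * X j ^ r) ^ s) ≤ r * s := by
  constructor
  · refine (degreeOf_pow_le i _ s).trans ?_
    have : degreeOf i (X i + C c * X j ^ r) ≤ 1 := by
      refine (degreeOf_add_le _ _ _).trans (max_le (by simp) ?_)
      refine (degreeOf_C_mul_le _ _ _).trans ?_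
      rw [degreeOf_X_pow_of_ne _ hij]
      exact zero_le_one
    nlinarith
  · refine (degreeOf_pow_le j _ s).trans ?_
    have : degreeOf j (X i + C c * X j ^ r) ≤ r := by
      refine (degreeOf_add_le _ _ _).trans (max_le ?_ ?_)
      · rw [degreeOf_X_of_ne hij.symm]; exact zero_le
      refine (degreeOf_C_mul_le _ _ _).trans ?_
      rw [degreeOf_X_self_pow]
    rw [mul_comm]
    exact Nat.mul_le_mul_right _ this

open MvPolynomial in
theorem degreeOf_elementary_sub_lt {k σ : Type*} [Field k] {i j : σ} (hij : i ≠ j) (c : k)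
    {r s l n : ℕ} (hr : 0 < r) (hn : 0 < n) (h : r * s + l = n) :
    degreeOf j ((X i + C c * X j ^ r) ^ s * X j ^ l - C (c ^ s) * X j ^ n) < n := by
  have hpow (t : ℕ) : (C c * X j ^ r : MvPolynomial σ k) ^ t = C (c ^ t) * X j ^ (r * t) := by
    rw [mul_pow, ← pow_mul, C_pow]
  have heq : (X i + C c * X j ^ r) ^ s * X j ^ l - C (c ^ s) * X j ^ n =
      (∑ t ∈ Finset.range s, (X i + C c * X j ^ r) ^ t * (C c * X j ^ r) ^ (s - 1 - t)) *
        X i * X j ^ l := by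
    have := (Commute.all (X i + C c * X j ^ r) (C c * X j ^ r : MvPolynomial σ k)).geom_sum₂_mul s
    rw [add_sub_cancel_right, hpow] at this
    rw [this, ← h, pow_add]
    ring
  rw [heq]
  rcases Nat.eq_zero_or_pos s with rfl | hs
  · simpa using hn
  have h₁ : degreeOf j (∑ t ∈ Finset.range s,
      (X i + C c * X j ^ r) ^ t * (C c * X j ^ r) ^ (s - 1 - t)) ≤ r * (s - 1) := by
    refine (degreeOf_sum_le _ _ _).trans (Finset.sup_le fun t ht ↦ ?_)
    refine (degreeOf_mul_le _ _ _).trans ?_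
    have h₂ := (degreeOf_add_mul_pow_le hij c r t).2
    have h₃ : degreeOf j ((C c * X j ^ r : MvPolynomial σ k) ^ (s - 1 - t)) ≤ r * (s - 1 - t) := by
      rw [hpow]
      exact (degreeOf_C_mul_le _ _ _).trans (degreeOf_X_self_pow _ _).le
    have : s - 1 = t + (s - 1 - t) := by have := Finset.mem_range.1 ht; omega
    conv_rhs => rw [this, mul_add]
    exact add_le_add h₂ h₃
  have h₂ := degreeOf_mul_le j ((∑ t ∈ Finset.range s,
      (X i + C c * X j ^ r) ^ t * (C c * X j ^ r : MvPolynomial σ k) ^ (s - 1 - t)) * X i) (X j ^ l)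
  have h₃ := degreeOf_mul_le j (∑ t ∈ Finset.range s,
      (X i + C c * X j ^ r) ^ t * (C c * X j ^ r : MvPolynomial σ k) ^ (s - 1 - t)) (X i)
  rw [degreeOf_X_of_ne hij.symm] at h₃
  rw [degreeOf_X_self_pow] at h₂
  have : r * s = r * (s - 1) + r := by
    obtain ⟨s, rfl⟩ := Nat.exists_eq_succ_of_ne_zero hs.ne'
    simp [mul_add]
  omega

open MvPolynomial in
theorem degreeOf_elementary_lt {k : Type*} [Field k] {i j : Fin 2} (hij : i ≠ j) {c : k} {r n : ℕ}
    (hr : 0 < r) (hn : 0 < n) {G : MvPolynomial (Fin 2) k}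
    {e : MvPolynomial (Fin 2) k ≃ₐ[k] MvPolynomial (Fin 2) k}
    (hi : e (X i) = X i + C c * X j ^ r) (hj : e (X j) = X j)
    (hG : ∀ z ∈ G.support, r * z i + z j ≤ n)
    (hc : ∑ z ∈ G.support with r * z i + z j = n, G.coeff z * c ^ z i = 0) :
    degreeOf j (e G) < n ∧ degreeOf i (e G) ≤ degreeOf i G := by
  have hsum : e G = ∑ z ∈ G.support, C (G.coeff z) * ((X i + C c * X j ^ r) ^ z i * X j ^ z j) := by
    conv_lhs => rw [G.as_sum, map_sum]
    refine Finset.sum_congr rfl fun z _ ↦ ?_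
    rw [monomial_eq, map_mul, ← algebraMap_eq, AlgEquiv.commutes,
      Finsupp.prod_fintype _ _ (by simp),
      ← Finset.mul_prod_erase Finset.univ _ (Finset.mem_univ i)]
    have : Finset.univ.erase i = {j} := by
      exact (by decide : ∀ i j : Fin 2, i ≠ j → Finset.univ.erase i = {j}) i j hij
    rw [this, Finset.prod_singleton, map_mul, map_pow, map_pow, hi, hj, algebraMap_eq]
  constructor
  · have hsplit : e G =
        ∑ z ∈ G.support with r * z i + z j = n,
          C (G.coeff z) * ((X i + C c * X j ^ r) ^ z i * X j ^ z j - C (c ^ z i) * X j ^ n) +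
        ∑ z ∈ G.support with ¬ r * z i + z j = n,
          C (G.coeff z) * ((X i + C c * X j ^ r) ^ z i * X j ^ z j) := by
      have h0 : ∑ z ∈ G.support with r * z i + z j = n,
          C (G.coeff z) * (C (c ^ z i) * (X j : MvPolynomial (Fin 2) k) ^ n) = 0 := by
        have := congrArg (fun a ↦ C a * (X j : MvPolynomial (Fin 2) k) ^ n) hc
        simp only [map_sum, Finset.sum_mul, map_zero, zero_mul, map_mul] at this
        rw [← this]
        exact Finset.sum_congr rfl fun z _ ↦ by ring
      rw [hsum, ← Finset.sum_filter_add_sum_filter_not G.support (fun z ↦ r * z i + z j = n)]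
      simp only [mul_sub, Finset.sum_sub_distrib]
      rw [h0, sub_zero]
    rw [hsplit]
    refine (degreeOf_add_le _ _ _).trans_lt (max_lt ?_ ?_)
    · refine (degreeOf_sum_le _ _ _).trans_lt ((Finset.sup_lt_iff hn).2 fun z hz ↦ ?_)
      exact (degreeOf_C_mul_le _ _ _).trans_lt
        (degreeOf_elementary_sub_lt hij c hr hn (Finset.mem_filter.1 hz).2)
    · refine (degreeOf_sum_le _ _ _).trans_lt ((Finset.sup_lt_iff hn).2 fun z hz ↦ ?_)
      obtain ⟨hz, hne⟩ := Finset.mem_filter.1 hz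
      have h₁ := (degreeOf_add_mul_pow_le hij c r (z i)).2
      have h₂ := degreeOf_mul_le j ((X i + C c * X j ^ r) ^ z i) (X j ^ z j)
      rw [degreeOf_X_self_pow] at h₂
      have h₃ := degreeOf_C_mul_le ((X i + C c * X j ^ r) ^ z i * X j ^ z j) j (G.coeff z)
      have := hG z hz
      omega
  · rw [hsum]
    refine (degreeOf_sum_le _ _ _).trans (Finset.sup_le fun z hz ↦ ?_)
    have h₁ := (degreeOf_add_mul_pow_le hij c r (z i)).1
    have h₂ := degreeOf_mul_le i ((X i + C c * X j ^ r) ^ z i) (X j ^ z j)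
    rw [degreeOf_X_pow_of_ne _ hij] at h₂
    have h₃ := degreeOf_C_mul_le ((X i + C c * X j ^ r) ^ z i * X j ^ z j) i (G.coeff z)
    have := degreeOf_le_iff.1 (le_refl (degreeOf i G)) z hz
    omega

open IntermediateField algebraAdjoinAdjoin in
theorem isAlgebraic_algebra_adjoin_iff {k L : Type*} [Field k] [Field L] [Algebra k L] {s : Set L}
    {x : L} : IsAlgebraic (Algebra.adjoin k s) x ↔ IsAlgebraic (IntermediateField.adjoin k s) x :=
  IsFractionRing.isAlgebraic_iff _ _ _

theorem algebraicIndependent_of_adjoin_eq_top {k L : Type*} [Field k] [Field L] [Algebra k L]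
    {x y f g : L} (hxy : AlgebraicIndependent k ![x, y])
    (h : IntermediateField.adjoin k {f, g} = ⊤) : AlgebraicIndependent k ![f, g] := by
  have : Algebra.IsAlgebraic (Algebra.adjoin k (Set.range ![f, g])) L := by
    refine ⟨fun z ↦ isAlgebraic_algebra_adjoin_iff.2 ?_⟩
    have hz : z ∈ IntermediateField.adjoin k (Set.range ![f, g]) := by
      rw [Matrix.range_cons_cons_empty, h]
      trivial
    exact isAlgebraic_algebraMap (⟨z, hz⟩ : IntermediateField.adjoin k (Set.range ![f, g]))
  exact (Algebra.IsAlgebraic.isTranscendenceBasis_of_lift_le_trdeg_of_finite k _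
    hxy.lift_cardinalMk_le_trdeg).1

theorem AlgebraicIndependent.transcendental_adjoin_simple {k L : Type*} [Field k] [Field L]
    [Algebra k L] {f g : L} (h : AlgebraicIndependent k ![f, g]) :
    Transcendental (IntermediateField.adjoin k {f}) g := by
  have := h.transcendental_adjoin (s := {0}) (i := 1) (by simp)
  rw [Set.image_singleton] at this
  exact fun h' ↦ this (isAlgebraic_algebra_adjoin_iff.2 h')

theorem mem_of_isAlgebraic_of_adjoin_simple_eq_top {K L : Type*} [Field K] [Field L] [Algebra K L]
    {g : L} (hg : Transcendental K g) (h : IntermediateField.adjoin K {g} = ⊤) {y : L}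
    (hy : IsAlgebraic K y) : y ∈ (algebraMap K L).range := by
  let e := RatFunc.algEquivOfTranscendental g hg
  obtain ⟨s, hs⟩ := e.surjective ⟨y, h ▸ trivial⟩
  have hy' : IsAlgebraic K s := by
    rw [← isAlgebraic_algHom_iff ((IntermediateField.val _).comp e.toAlgHom)
      (RingHom.injective _)]
    have : ((IntermediateField.val _).comp e.toAlgHom) s = y := by simp [hs]
    rwa [this]
  by_contra hc
  refine RatFunc.transcendental_of_ne_C s (fun ⟨c, hc'⟩ ↦ hc ⟨c, ?_⟩) hy'
  have : algebraMap K _ c = e s := by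
    rw [hc', ← RatFunc.algebraMap_eq_C, AlgEquiv.commutes]
  rw [hs] at this
  exact congrArg Subtype.val this

theorem adjoin_eq_top_of_aeval {k L : Type*} [Field k] [Field L] [Algebra k L]
    {x y g : L} {P : Polynomial k} (hxy : AlgebraicIndependent k ![x, y])
    (htop : IntermediateField.adjoin k {x, y} = ⊤)
    (h : IntermediateField.adjoin k {Polynomial.aeval y P, g} = ⊤) :
    IntermediateField.adjoin k {Polynomial.aeval y P, x} = ⊤ := by
  obtain ⟨f, hf⟩ : ∃ f, Polynomial.aeval y P = f := ⟨_, rfl⟩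
  rw [hf] at h ⊢
  have hfg := algebraicIndependent_of_adjoin_eq_top hxy h
  have hy : IsAlgebraic (IntermediateField.adjoin k {f}) y := by
    refine ⟨P.map (algebraMap k _) - Polynomial.C ⟨f, IntermediateField.mem_adjoin_simple_self k f⟩,
      fun h0 ↦ ?_, by simp [hf]⟩
    have hdeg : P.natDegree = 0 := by
      rw [← Polynomial.natDegree_map (algebraMap k (IntermediateField.adjoin k {f})),
        sub_eq_zero.1 h0, Polynomial.natDegree_C]
    rw [Polynomial.eq_C_of_natDegree_eq_zero hdeg, Polynomial.aeval_C] at hf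
    exact hfg.transcendental 0 (by simpa [← hf] using isAlgebraic_algebraMap _)
  have hmem := mem_of_isAlgebraic_of_adjoin_simple_eq_top hfg.transcendental_adjoin_simple (by
    rw [← IntermediateField.restrictScalars_eq_top_iff (K := k),
      IntermediateField.adjoin_adjoin_left, Set.singleton_union, h]) hy
  obtain ⟨y', rfl⟩ := hmem
  rw [eq_top_iff, ← htop, IntermediateField.adjoin_le_iff]
  rintro z (rfl | rfl)
  · exact IntermediateField.subset_adjoin _ _ (by simp)
  · exact IntermediateField.adjoin.mono _ _ _ (by simp) y'.2

open MvPolynomial in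
theorem exists_eq_aeval_add_mul_of_degreeOf_le_one {k : Type*} [Field k] {i j : Fin 2} (hij : i ≠ j)
    {G : MvPolynomial (Fin 2) k} (h : degreeOf i G ≤ 1) :
    ∃ P Q : Polynomial k, G = Polynomial.aeval (X j) P + X i * Polynomial.aeval (X j) Q := by
  refine ⟨∑ z ∈ G.support with z i = 0, Polynomial.monomial (z j) (G.coeff z),
    ∑ z ∈ G.support with ¬ z i = 0, Polynomial.monomial (z j) (G.coeff z), ?_⟩
  conv_lhs => rw [G.as_sum, ← Finset.sum_filter_add_sum_filter_not _ (fun z ↦ z i = 0)]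
  have key (z : Fin 2 →₀ ℕ) : monomial z (G.coeff z) =
      X i ^ z i * Polynomial.aeval (X j) (Polynomial.monomial (z j) (G.coeff z)) := by
    rw [monomial_eq, Finsupp.prod_fintype _ _ (by simp),
      ← Finset.mul_prod_erase Finset.univ _ (Finset.mem_univ i),
      (by decide : ∀ i j : Fin 2, i ≠ j → Finset.univ.erase i = {j}) i j hij,
      Finset.prod_singleton, Polynomial.aeval_monomial, algebraMap_eq]
    ring
  rw [map_sum, map_sum, Finset.mul_sum]
  congr 1 <;> refine Finset.sum_congr rfl fun z hz ↦ ?_ <;>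
    obtain ⟨hz, hzi⟩ := Finset.mem_filter.1 hz
  · rw [key, hzi, pow_zero, one_mul]
  · have := degreeOf_le_iff.1 h z hz
    rw [key, show z i = 1 by omega, pow_one]

theorem eq_top_of_algebraMap_mem {k L : Type*} [Field k] [Field L]
    [Algebra (MvPolynomial (Fin 2) k) L] [IsFractionRing (MvPolynomial (Fin 2) k) L]
    [Algebra k L] [IsScalarTower k (MvPolynomial (Fin 2) k) L]
    (φ : MvPolynomial (Fin 2) k ≃ₐ[k] MvPolynomial (Fin 2) k) {K : IntermediateField k L}
    (h : ∀ i, algebraMap _ L (φ (MvPolynomial.X i)) ∈ K) : K = ⊤ := by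
  have h' (P : MvPolynomial (Fin 2) k) : algebraMap _ L P ∈ K := by
    obtain ⟨P, rfl⟩ := φ.surjective P
    induction P using MvPolynomial.induction_on with
    | C a =>
      rw [← MvPolynomial.algebraMap_eq, AlgEquiv.commutes, ← IsScalarTower.algebraMap_apply]
      exact K.algebraMap_mem a
    | add P Q hP hQ => rw [map_add, map_add]; exact add_mem hP hQ
    | mul_X P i hP => rw [map_mul, map_mul]; exact mul_mem hP (h i)
  refine eq_top_iff.2 fun z _ ↦ ?_
  obtain ⟨P, Q, -, rfl⟩ := IsFractionRing.div_surjective (A := MvPolynomial (Fin 2) k) z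
  exact div_mem (h' P) (h' Q)

open MvPolynomial in
theorem exists_adjoin_eq_top_of_degreeOf_le_one {k L : Type*} [Field k] [Field L]
    [Algebra (MvPolynomial (Fin 2) k) L] [IsFractionRing (MvPolynomial (Fin 2) k) L]
    [Algebra k L] [IsScalarTower k (MvPolynomial (Fin 2) k) L]
    (φ : MvPolynomial (Fin 2) k ≃ₐ[k] MvPolynomial (Fin 2) k) {G : MvPolynomial (Fin 2) k} {g : L}
    (hg : IntermediateField.adjoin k {algebraMap _ L (φ G), g} = ⊤) {i : Fin 2}
    (h : degreeOf i G ≤ 1) : ∃ H : MvPolynomial (Fin 2) k,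
      IntermediateField.adjoin k {algebraMap _ L (φ G), algebraMap _ L H} = ⊤ := by
  obtain ⟨j, hij⟩ : ∃ j, i ≠ j := (by decide : ∀ i : Fin 2, ∃ j, i ≠ j) i
  have hall : ∀ l, l = i ∨ l = j := fun l ↦ by omega
  obtain ⟨P, Q, rfl⟩ := exists_eq_aeval_add_mul_of_degreeOf_le_one hij h
  let ψ : MvPolynomial (Fin 2) k →ₐ[k] L := (IsScalarTower.toAlgHom k _ L).comp φ.toAlgHom
  have hψ : Function.Injective ψ := (IsFractionRing.injective _ L).comp φ.injective
  have hψa (P) : algebraMap _ L (φ P) = ψ P := rfl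
  have htop (K : IntermediateField k L) (hi : ψ (X i) ∈ K) (hj : ψ (X j) ∈ K) : K = ⊤ := by
    refine eq_top_of_algebraMap_mem φ fun l ↦ ?_
    rcases hall l with rfl | rfl <;> assumption
  have hF : algebraMap _ L (φ (Polynomial.aeval (X j) P + X i * Polynomial.aeval (X j) Q)) =
      Polynomial.aeval (ψ (X j)) P + ψ (X i) * Polynomial.aeval (ψ (X j)) Q := by
    rw [hψa, map_add, map_mul, Polynomial.aeval_algHom_apply, Polynomial.aeval_algHom_apply]
  rw [hF] at hg ⊢
  have hsub (S : Set L) {z : L} (hz : z ∈ S) := IntermediateField.subset_adjoin k S hz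
  rcases eq_or_ne Q 0 with rfl | hQ
  · simp only [map_zero, mul_zero, add_zero] at hg ⊢
    have hind : AlgebraicIndependent k ![ψ (X i), ψ (X j)] := by
      have := ((MvPolynomial.algebraicIndependent_X (Fin 2) k).map' hψ).comp ![i, j] (by
        intro s t; fin_cases s <;> fin_cases t <;> simp [hij, hij.symm])
      convert this using 1
      ext s
      fin_cases s <;> rfl
    exact ⟨φ (X i), adjoin_eq_top_of_aeval hind
      (htop _ (hsub _ (by simp [hψa])) (hsub _ (by simp))) hg⟩
  · refine ⟨φ (X j), ?_⟩
    rw [hψa]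
    set K := IntermediateField.adjoin k
      {Polynomial.aeval (ψ (X j)) P + ψ (X i) * Polynomial.aeval (ψ (X j)) Q, ψ (X j)} with hK
    have hF' : Polynomial.aeval (ψ (X j)) P + ψ (X i) * Polynomial.aeval (ψ (X j)) Q ∈ K :=
      hsub _ (by simp)
    have hj : ψ (X j) ∈ K := hsub _ (by simp)
    have hpoly (R : Polynomial k) : Polynomial.aeval (ψ (X j)) R ∈ K :=
      Algebra.adjoin_le (S := K.toSubalgebra) (Set.singleton_subset_iff.2 hj)
        (Polynomial.aeval_mem_adjoin_singleton k _)
    have hQ0 : Polynomial.aeval (ψ (X j)) Q ≠ 0 := by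
      rw [Polynomial.aeval_algHom_apply, ne_eq, map_eq_zero_iff _ hψ]
      exact fun h0 ↦ MvPolynomial.transcendental_X k j ⟨Q, hQ, h0⟩
    refine htop K ?_ hj
    have : ψ (X i) = (Polynomial.aeval (ψ (X j)) P + ψ (X i) * Polynomial.aeval (ψ (X j)) Q -
        Polynomial.aeval (ψ (X j)) P) / Polynomial.aeval (ψ (X j)) Q := by
      rw [add_sub_cancel_left, mul_div_cancel_right₀ _ hQ0]
    rw [this]
    exact div_mem (sub_mem hF' (hpoly P)) (hpoly Q)

theorem eval_edgePoly {k : Type*} [Field k] (a b p q e : ℕ) (G : MvPolynomial (Fin 2) k) (r : k) :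
    (edgePoly a b p q e G).eval r =
      ∑ m ∈ G.support with p * m 0 + q * m 1 = e, G.coeff m * r ^ (a * m 0 + b * m 1) := by
  simp [edgePoly, Polynomial.eval_finsetSum]

open MvPolynomial in
theorem exists_degreeOf_add_lt {k L : Type*} [Field k] [Field L]
    [Algebra (MvPolynomial (Fin 2) k) L] [IsFractionRing (MvPolynomial (Fin 2) k) L]
    [Algebra k L] [IsScalarTower k (MvPolynomial (Fin 2) k) L]
    (φ : MvPolynomial (Fin 2) k ≃ₐ[k] MvPolynomial (Fin 2) k) {G : MvPolynomial (Fin 2) k} {g : L}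
    (hg : IntermediateField.adjoin k {algebraMap _ L (φ G), g} = ⊤) (h₁ : 0 < degreeOf 1 G)
    (hc : ∀ z ∈ G.support, ¬ (z 0 = degreeOf 0 G ∧ z 1 = degreeOf 1 G)) :
    ∃ e : MvPolynomial (Fin 2) k ≃ₐ[k] MvPolynomial (Fin 2) k,
      degreeOf 0 (e G) + degreeOf 1 (e G) < degreeOf 0 G + degreeOf 1 G := by
  have hG0 : G.support.Nonempty := by
    rw [support_nonempty]
    rintro rfl
    simp at h₁
  have hmax (i : Fin 2) : ∃ z ∈ G.support, z i = degreeOf i G := by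
    obtain ⟨z, hz, h⟩ := Finset.exists_mem_eq_sup G.support hG0 (fun z ↦ z i)
    exact ⟨z, hz, by rw [degreeOf_eq_sup, h]⟩
  have hle (i : Fin 2) (z) (hz : z ∈ G.support) : z i ≤ degreeOf i G :=
    degreeOf_le_iff.1 le_rfl z hz
  obtain ⟨p, q, hp, hq, hpq, u, hu, w, hw, huw, hline, hun, hd'⟩ :=
    exists_edge (fun z hz ↦ ⟨hle 0 z hz, hle 1 z hz⟩) (hmax 0) (hmax 1) hc
  obtain ⟨a, b, hab⟩ := exists_bezout_nat hp hq hpq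
  obtain ⟨d, hd⟩ : ∃ d, p * u 0 + q * u 1 = d := ⟨_, rfl⟩
  rw [hd] at hline hd'
  have hd0 : 0 < d := by
    have := Nat.mul_pos hq (hun ▸ h₁)
    omega
  have hcoeff (z : Fin 2 →₀ ℕ) (hz : z ∈ G.support) (h : p * z 0 + q * z 1 = d) :
      (edgePoly a b p q d G).coeff (a * z 0 + b * z 1) ≠ 0 := by
    rw [edgePoly_coeff hab z h]
    exact mem_support_iff.1 hz
  obtain ⟨A, B, hAB, hB, hℓ, hA, hAℓ⟩ := exists_eq_X_pow_mul (hcoeff u hu hd) (hcoeff w hw hline)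
    fun h ↦ huw (by
      obtain ⟨h₁, h₂⟩ := eq_of_edge hab (hd.trans hline.symm) h
      ext i
      fin_cases i <;> assumption)
  obtain ⟨v, hv, hvd, hvA⟩ := exists_of_edgePoly_coeff_ne_zero hA
  obtain ⟨v', hv', hvd', hvA'⟩ := exists_of_edgePoly_coeff_ne_zero hAℓ
  obtain ⟨hℓd, hℓe⟩ := natDegree_edge_le hp hq hab hvd hvd' (by rw [hvA', hvA])
  obtain ⟨⟨r, hr, hrB⟩, hdiv⟩ :=
    root_and_dvd_of_adjoin_eq_top φ hg hab hd0 hd' hAB hB hℓ hℓd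
  have hsum : ∑ m ∈ G.support with p * m 0 + q * m 1 = d,
      G.coeff m * r ^ (a * m 0 + b * m 1) = 0 := by
    rw [← eval_edgePoly, hAB, Polynomial.eval_mul, hrB, mul_zero]
  have hvertex : (q = 1 ∧ ∃ z ∈ G.support, z 1 = d) ∨ (p = 1 ∧ ∃ z ∈ G.support, z 0 = d) := by
    rcases hdiv with h | h | h
    · rcases extremal_of_dvd hp hq hab hd0 hvd (hvA.symm ▸ h) with h | h
      · exact Or.inl ⟨h.1, v, hv, h.2.2⟩
      · exact Or.inr ⟨h.1, v, hv, h.2.1⟩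
    · rcases extremal_of_dvd hp hq hab hd0 hvd' (hvA'.symm ▸ h) with h | h
      · exact Or.inl ⟨h.1, v', hv', h.2.2⟩
      · exact Or.inr ⟨h.1, v', hv', h.2.1⟩
    · rcases hℓe h with h | h
      · omega
      · exact Or.inr ⟨h.1, v', hv', h.2.1⟩
  rcases hvertex with ⟨rfl, z, hz, hzd⟩ | ⟨rfl, z, hz, hzd⟩
  · obtain ⟨e, he₀, he₁⟩ := exists_elementary (i := 0) (j := 1) (by decide) r p
    refine ⟨e, ?_⟩
    have := degreeOf_elementary_lt (by decide) hp hd0 he₀ he₁ (by simpa using hd') (by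
      apply mul_left_cancel₀ (pow_ne_zero (b * d) hr)
      rw [mul_zero, ← hsum, Finset.mul_sum]
      simp only [one_mul]
      refine Finset.sum_congr rfl fun m hm ↦ ?_
      have hE : a * m 0 + b * m 1 = b * d + m 0 := by
        rw [← (Finset.mem_filter.1 hm).2]
        linear_combination m 0 * hab
      rw [hE, pow_add]
      ring)
    have := hle 1 z hz
    omega
  · obtain ⟨e, he₁, he₀⟩ := exists_elementary (i := 1) (j := 0) (by decide) r⁻¹ q
    refine ⟨e, ?_⟩
    have := degreeOf_elementary_lt (by decide) hq hd0 he₁ he₀ (by simpa [add_comm] using hd') (by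
      apply mul_left_cancel₀ (pow_ne_zero (a * d) hr)
      rw [mul_zero, ← hsum, Finset.mul_sum]
      simp only [one_mul, add_comm (q * _)]
      refine Finset.sum_congr rfl fun m hm ↦ ?_
      have hE : a * m 0 + b * m 1 + m 1 = a * d := by
        rw [← (Finset.mem_filter.1 hm).2, mul_add, ← mul_assoc, hab]
        ring
      rw [← hE, pow_add, inv_pow]
      field_simp)
    have := hle 0 z hz
    omega

open MvPolynomial in
theorem exists_rectangular {k L : Type*} [Field k] [Field L]
    [Algebra (MvPolynomial (Fin 2) k) L] [IsFractionRing (MvPolynomial (Fin 2) k) L]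
    [Algebra k L] [IsScalarTower k (MvPolynomial (Fin 2) k) L]
    {F : MvPolynomial (Fin 2) k} {g : L}
    (hg : IntermediateField.adjoin k {algebraMap _ L F, g} = ⊤)
    (hbad : ¬ ∃ G : MvPolynomial (Fin 2) k,
      IntermediateField.adjoin k {algebraMap _ L F, algebraMap _ L G} = ⊤) :
    ∃ (φ : MvPolynomial (Fin 2) k ≃ₐ[k] MvPolynomial (Fin 2) k) (G : MvPolynomial (Fin 2) k),
      φ G = F ∧ 0 < degreeOf 0 G ∧ 0 < degreeOf 1 G ∧
      G.coeff (Finsupp.single 0 (degreeOf 0 G) + Finsupp.single 1 (degreeOf 1 G)) ≠ 0 := by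
  have key (N : ℕ) (φ : MvPolynomial (Fin 2) k ≃ₐ[k] MvPolynomial (Fin 2) k)
      (G : MvPolynomial (Fin 2) k) (hφ : φ G = F) (hN : degreeOf 0 G + degreeOf 1 G = N) :
      ∃ (φ : MvPolynomial (Fin 2) k ≃ₐ[k] MvPolynomial (Fin 2) k) (G : MvPolynomial (Fin 2) k),
        φ G = F ∧ 0 < degreeOf 0 G ∧ 0 < degreeOf 1 G ∧
        G.coeff (Finsupp.single 0 (degreeOf 0 G) + Finsupp.single 1 (degreeOf 1 G)) ≠ 0 := by
    induction N using Nat.strong_induction_on generalizing φ G with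
    | _ N ih =>
      subst hφ hN
      have hpos (i : Fin 2) : 0 < degreeOf i G := by
        by_contra h
        exact hbad (exists_adjoin_eq_top_of_degreeOf_le_one φ hg (i := i) (by omega))
      by_cases hc : G.coeff (Finsupp.single 0 (degreeOf 0 G) + Finsupp.single 1 (degreeOf 1 G)) = 0
      · obtain ⟨e, he⟩ := exists_degreeOf_add_lt φ hg (hpos 1) fun z hz ⟨h₀, h₁⟩ ↦ by
          rw [mem_support_iff] at hz
          refine hz (Eq.trans (congrArg G.coeff ?_) hc)
          ext i
          fin_cases i <;> simp [h₀, h₁]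
        exact ih _ he (e.symm.trans φ) (e G) (by simp) rfl
      · exact ⟨φ, G, rfl, hpos 0, hpos 1, hc⟩
  exact key _ AlgEquiv.refl F rfl rfl

open MvPolynomial

/-- If `F` is a bad field generator of `A = k[X,Y]`, then `F` is not a
variable of `A`, `F` is a rectangular element of `A`, and the pair `(m,n) = bideg_A(F)`
(i.e. the pair attached to any coordinate system w.r.t. which `F` is rectangular,
normalized so that `m ≤ n`) satisfies `2 ≤ m ≤ n`. -/
theorem stmt15 (k : Type) [Field k] (L : Type) [Field L]
    [Algebra (MvPolynomial (Fin 2) k) L] [IsFractionRing (MvPolynomial (Fin 2) k) L]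
    [Algebra k L] [IsScalarTower k (MvPolynomial (Fin 2) k) L]
    (F : MvPolynomial (Fin 2) k)
    (hFG : ∃ g : L, IntermediateField.adjoin k
        {algebraMap (MvPolynomial (Fin 2) k) L F, g} = ⊤)
    (hbad : ¬ ∃ G : MvPolynomial (Fin 2) k, IntermediateField.adjoin k
        {algebraMap (MvPolynomial (Fin 2) k) L F,
         algebraMap (MvPolynomial (Fin 2) k) L G} = ⊤) :
    (¬ ∃ G : MvPolynomial (Fin 2) k,
        Algebra.adjoin k ({F, G} : Set (MvPolynomial (Fin 2) k)) = ⊤)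
    ∧ (∃ (U V G : MvPolynomial (Fin 2) k) (m n : ℕ),
        Function.Bijective ⇑(MvPolynomial.aeval (R := k) ![U, V]) ∧
        MvPolynomial.aeval ![U, V] G = F ∧ 1 ≤ m ∧ 1 ≤ n ∧
        MvPolynomial.coeff (Finsupp.single 0 m + Finsupp.single 1 n) G ≠ 0 ∧
        (∀ d ∈ G.support, d 0 ≤ m ∧ d 1 ≤ n))
    ∧ (∀ (U V G : MvPolynomial (Fin 2) k) (m n : ℕ),
        Function.Bijective ⇑(MvPolynomial.aeval (R := k) ![U, V]) →
        MvPolynomial.aeval ![U, V] G = F →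
        MvPolynomial.coeff (Finsupp.single 0 m + Finsupp.single 1 n) G ≠ 0 →
        (∀ d ∈ G.support, d 0 ≤ m ∧ d 1 ≤ n) →
        m ≤ n → 2 ≤ m) := by
  obtain ⟨g, hg⟩ := hFG
  refine ⟨?_, ?_, ?_⟩
  · rintro ⟨G, hG⟩
    refine hbad ⟨G, eq_top_of_algebraMap_mem AlgEquiv.refl fun i ↦ ?_⟩
    have hle : (Algebra.adjoin k {F, G}).map (IsScalarTower.toAlgHom k _ L) ≤
        (IntermediateField.adjoin k
          {algebraMap (MvPolynomial (Fin 2) k) L F, algebraMap _ L G}).toSubalgebra := by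
      rw [AlgHom.map_adjoin, Set.image_pair]
      exact IntermediateField.algebra_adjoin_le_adjoin _ _
    exact hle ⟨X i, by rw [hG]; trivial, rfl⟩
  · obtain ⟨φ, G, hφ, h₀, h₁, hc⟩ := exists_rectangular hg hbad
    have hUV : aeval ![φ (X 0), φ (X 1)] = (φ : MvPolynomial (Fin 2) k →ₐ[k] _) := by
      ext i
      fin_cases i <;> simp
    exact ⟨φ (X 0), φ (X 1), G, degreeOf 0 G, degreeOf 1 G, hUV ▸ φ.bijective, hUV ▸ hφ, h₀, h₁, hc,
      fun d hd ↦ ⟨degreeOf_le_iff.1 le_rfl d hd, degreeOf_le_iff.1 le_rfl d hd⟩⟩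
  · rintro U V G m n hUV rfl - hG -
    by_contra hm
    refine hbad (exists_adjoin_eq_top_of_degreeOf_le_one (AlgEquiv.ofBijective _ hUV) hg
      (i := 0) (degreeOf_le_iff.2 fun d hd ↦ ?_))
    have := (hG d hd).1
    omega
end

section
/- Let k be a field and F a field generator of A = k[X,Y] with dicritical degree list Δ(F,A) = [d₁,…,d_t]. If gcd of the multiset {d₁,…,d_t} \ {1} is greater than 1 (in particular if at most one d_i exceeds 1), then F is a very good field generator of A: for every polynomial subring A' = k[U,V] ⊆ A with Frac(A') = Frac(A) and F ∈ A', F is a good field generator of A'. -/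
open MvPolynomial

set_option synthInstance.maxHeartbeats 1000000 in
open Classical in
/-- The residue degree `[R/m_R : K]` of a valuation ring `R` of `L` over a subfield
`K ⊆ R` (junk value `0` if `K ⊄ R`). -/
noncomputable def resDeg {L : Type} [Field L] (K : Subfield L) (R : ValuationSubring L) : ℕ :=
  if h : (K : Set L) ⊆ (R : Set L) then
    @Module.finrank K (R ⧸ IsLocalRing.maximalIdeal R) _ _
      (Module.compHom _ ((Ideal.Quotient.mk (IsLocalRing.maximalIdeal R)).comp
        { toFun := fun x => (⟨(x : L), h x.2⟩ : R),
          map_one' := rfl, map_mul' := fun _ _ => rfl,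
          map_zero' := rfl, map_add' := fun _ _ => rfl }))
  else 0

section Valuation

variable {L : Type*} [Field L] {K : Subfield L} {t : L} {W : ValuationSubring L}

/-- A valuation subring containing a subfield has trivial valuation on it. -/
theorem valuation_isTrivialOn_subfield (hK : (K : Set L) ⊆ W) : W.valuation.IsTrivialOn K where
  eq_one x hx := by
    have h0 : (x : L) ≠ 0 := fun h => hx (Subtype.ext h)
    have h1 : W.valuation (x : L) ≤ 1 := (W.valuation_le_one_iff _).2 (hK x.2)
    have h2 : W.valuation (x : L)⁻¹ ≤ 1 :=
      (W.valuation_le_one_iff _).2 (hK (K.inv_mem x.2))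
    rw [map_inv₀] at h2
    exact le_antisymm h1 ((inv_le_one₀ (by simpa [zero_lt_iff] using h0)).1 h2)

theorem valuation_eq_one_of_mem_subfield (hK : (K : Set L) ⊆ W) {x : L} (hx : x ∈ K)
    (h0 : x ≠ 0) : W.valuation x = 1 :=
  (valuation_isTrivialOn_subfield hK).eq_one ⟨x, hx⟩ fun h => h0 (congrArg Subtype.val h)

theorem valuation_aeval_le_one (hK : (K : Set L) ⊆ W) (ht : t ∈ W) (u : Polynomial K) :
    W.valuation (Polynomial.aeval t u) ≤ 1 := by
  rw [W.valuation_le_one_iff, Polynomial.aeval_eq_sum_range]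
  refine sum_mem fun i _ => ?_
  rw [Algebra.smul_def]
  exact mul_mem (hK (u.coeff i).2) (pow_mem ht i)

theorem valuation_aeval_eq_pow (hK : (K : Set L) ⊆ W) (ht : t ∉ W) {u : Polynomial K}
    (hu : u ≠ 0) : W.valuation (Polynomial.aeval t u) = W.valuation t ^ u.natDegree := by
  have := valuation_isTrivialOn_subfield hK
  refine Polynomial.valuation_aeval_eq_valuation_X_pow_natDegree_of_one_lt_valuation_X t ?_ hu
  rwa [← not_le, W.valuation_le_one_iff]

theorem valuation_aeval_eq_one_of_isCoprime (hK : (K : Set L) ⊆ W) (ht : t ∈ W)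
    {u v : Polynomial K} (huv : IsCoprime u v) (hv : W.valuation (Polynomial.aeval t v) < 1) :
    W.valuation (Polynomial.aeval t u) = 1 := by
  refine le_antisymm (valuation_aeval_le_one hK ht u) ?_
  by_contra! hu
  obtain ⟨a, b, hab⟩ := huv
  have h1 : W.valuation (Polynomial.aeval t (a * u + b * v)) = 1 := by rw [hab]; simp
  rw [map_add, map_mul, map_mul] at h1
  refine h1.not_lt (Valuation.map_add_lt _ ?_ ?_) <;> rw [map_mul]
  · exact mul_lt_one_of_nonneg_of_lt_one_right (valuation_aeval_le_one hK ht a) zero_le hu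
  · exact mul_lt_one_of_nonneg_of_lt_one_right (valuation_aeval_le_one hK ht b) zero_le hv

theorem valuation_aeval_lt_one_iff_dvd (hK : (K : Set L) ⊆ W) (ht : t ∈ W)
    {p u : Polynomial K} (hp : Irreducible p) (hpW : W.valuation (Polynomial.aeval t p) < 1) :
    W.valuation (Polynomial.aeval t u) < 1 ↔ p ∣ u := by
  refine ⟨fun hu => ?_, ?_⟩
  · by_contra h
    exact hpW.ne (valuation_aeval_eq_one_of_isCoprime hK ht
      (hp.coprime_iff_not_dvd.2 h) hu)
  · rintro ⟨w, rfl⟩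
    rw [map_mul, map_mul]
    exact mul_lt_one_of_lt_of_le hpW (valuation_aeval_le_one hK ht w)

theorem exists_valuationSubring_aeval_lt_one (ht : Transcendental K t) {p : Polynomial K}
    (hp : Irreducible p) :
    ∃ R : ValuationSubring L, (K : Set L) ⊆ R ∧ t ∈ R ∧
      R.valuation (Polynomial.aeval t p) < 1 := by
  set A : Subring L := (Polynomial.aeval t : Polynomial K →ₐ[K] L).toRingHom.range
  have hpA : Polynomial.aeval t p ∈ A := ⟨p, rfl⟩
  have hI : Ideal.span {(⟨_, hpA⟩ : A)} ≠ ⊤ := by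
    rw [Ne, Ideal.span_singleton_eq_top, isUnit_iff_exists_inv]
    rintro ⟨⟨_, w, rfl⟩, hw⟩
    have hw' : Polynomial.aeval t (p * w) = Polynomial.aeval t (1 : Polynomial K) := by
      simpa using congrArg Subtype.val hw
    exact hp.not_isUnit (IsUnit.of_mul_eq_one _ (transcendental_iff_injective.1 ht hw'))
  obtain ⟨R, hAR, hR⟩ := Ideal.image_subset_nonunits_valuationSubring _ hI
  refine ⟨R, fun x hx => hAR ⟨Polynomial.C ⟨x, hx⟩, by simp; rfl⟩,
    hAR ⟨Polynomial.X, by simp⟩, ?_⟩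
  exact R.mem_nonunits_iff.1 (hR ⟨_, Ideal.mem_span_singleton_self _, rfl⟩)

/-- Every element of `K(t)` is a quotient of coprime polynomials in `t`. -/
theorem exists_isCoprime_mul_aeval_eq (ht : Transcendental K t)
    (hgen : ∀ M : Subfield L, K ≤ M → t ∈ M → M = ⊤) (x : L) :
    ∃ u v : Polynomial K, IsCoprime u v ∧ v ≠ 0 ∧
      x * Polynomial.aeval t v = Polynomial.aeval t u := by
  have hx : x ∈ IntermediateField.adjoin K {t} := by
    have := hgen (IntermediateField.adjoin K {t}).toSubfield
      (fun y hy => (IntermediateField.adjoin K {t}).algebraMap_mem ⟨y, hy⟩)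
      (IntermediateField.mem_adjoin_simple_self K t)
    change x ∈ (IntermediateField.adjoin K {t}).toSubfield
    rw [this]; trivial
  obtain ⟨r, s, hrs⟩ := (IntermediateField.mem_adjoin_simple_iff K x).1 hx
  by_cases hs : s = 0
  · exact ⟨0, 1, isCoprime_zero_left.2 isUnit_one, one_ne_zero, by simp [hrs, hs]⟩
  let := UniqueFactorizationMonoid.toGCDMonoid (Polynomial K)
  obtain ⟨u, v, hu, hv, huv⟩ := extract_gcd r s
  have hv0 : v ≠ 0 := by
    rintro rfl
    exact hs (hv.trans (mul_zero _))
  have hg0 : GCDMonoid.gcd r s ≠ 0 := fun h => hs (by rw [hv, h, zero_mul])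
  have hinj := transcendental_iff_injective.1 ht
  have hg0' := (map_ne_zero_iff _ hinj).2 hg0
  have hv0' := (map_ne_zero_iff _ hinj).2 hv0
  refine ⟨u, v, (gcd_isUnit_iff u v).1 huv, hv0, ?_⟩
  have hu' := congrArg (Polynomial.aeval t) hu
  have hv' := congrArg (Polynomial.aeval t) hv
  rw [map_mul] at hu' hv'
  rw [hrs, hu', hv', mul_div_mul_left _ _ hg0', div_mul_cancel₀ _ hv0']

theorem dvd_natDegree_of_forall_irreducible {k : Type*} [Field k] {e : ℕ} {w : Polynomial k}
    (hw : w ≠ 0) (h : ∀ p, Irreducible p → p ∣ w → e ∣ p.natDegree) : e ∣ w.natDegree := by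
  induction w using UniqueFactorizationMonoid.induction_on_prime with
  | h₁ => exact absurd rfl hw
  | h₂ x hx => simp [Polynomial.natDegree_eq_zero_of_isUnit hx]
  | h₃ a p ha hp ih =>
    rw [Polynomial.natDegree_mul hp.ne_zero ha]
    exact dvd_add (h p hp.irreducible (dvd_mul_right p a))
      (ih ha fun q hq hqa => h q hq (hqa.mul_left p))

end Valuation

section Localization

variable {L : Type*} [Field L] {K : Subfield L}
variable {B : Type*} [CommRing B] [IsDomain B] [Algebra B L] [IsFractionRing B L]

/-- An element of `Frac B` lying in every valuation ring containing `K` and `B` is a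
quotient of an element of `B` by an element of `B ∩ K`. -/
theorem exists_mul_eq_of_forall_valuationSubring [IsIntegrallyClosed B]
    (hS : ∀ x ∈ K, ∃ a b : B, algebraMap B L b ∈ K ∧ b ≠ 0 ∧
      x * algebraMap B L b = algebraMap B L a) {x : L}
    (hx : ∀ W : ValuationSubring L, (K : Set L) ⊆ W → (∀ b : B, algebraMap B L b ∈ W) → x ∈ W) :
    ∃ s b : B, s ≠ 0 ∧ algebraMap B L s ∈ K ∧ algebraMap B L s * x = algebraMap B L b := by
  let S : Submonoid B :=
    nonZeroDivisors B ⊓ (K.toSubring.toSubmonoid.comap (algebraMap B L : B →* L))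
  have hS' : S ≤ nonZeroDivisors B := inf_le_left
  let C := Localization.subalgebra.ofField L S hS'
  have : IsIntegrallyClosed C := isIntegrallyClosed_of_isLocalization C S hS'
  have : IsIntegrallyClosedIn C.toSubring L :=
    let _ : IsFractionRing C.toSubring L := inferInstanceAs (IsFractionRing C L)
    (isIntegrallyClosed_iff_isIntegrallyClosedIn L).1 this
  have key : x ∈ C.toSubring := by
    by_contra hxC
    obtain ⟨W, hW, hxW⟩ := Subring.exists_le_valuationSubring_of_isIntegrallyClosedIn hxC
    refine hxW (hx W (fun y hy => ?_) fun b => hW (C.algebraMap_mem b))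
    obtain ⟨a, b, hbK, hb, hab⟩ := hS y hy
    refine hW ⟨a, b, ⟨mem_nonZeroDivisors_of_ne_zero hb, hbK⟩, ?_⟩
    rw [← hab, mul_inv_cancel_right₀]
    simpa using hb
  obtain ⟨b, s, ⟨hs, hsK⟩, rfl⟩ := key
  have hs0 := nonZeroDivisors.ne_zero hs
  refine ⟨s, b, hs0, hsK, ?_⟩
  rw [mul_comm, inv_mul_cancel_right₀]
  simpa using hs0

omit [IsDomain B] [IsFractionRing B L] in
theorem exists_prime_dvd_valuation_lt_one [UniqueFactorizationMonoid B] {W : ValuationSubring L}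
    (hB : ∀ b : B, algebraMap B L b ∈ W) {c : B} (hc : c ≠ 0)
    (hcW : W.valuation (algebraMap B L c) < 1) :
    ∃ h : B, Prime h ∧ h ∣ c ∧ W.valuation (algebraMap B L h) < 1 := by
  induction c using UniqueFactorizationMonoid.induction_on_prime with
  | h₁ => exact absurd rfl hc
  | h₂ x hx =>
    obtain ⟨y, hy⟩ := hx.exists_right_inv
    have h1 := congrArg (fun z => W.valuation (algebraMap B L z)) hy
    rw [map_mul, map_mul, map_one, map_one] at h1
    exact absurd h1 (mul_lt_one_of_lt_of_le hcW ((W.valuation_le_one_iff _).2 (hB y))).ne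
  | h₃ a p ha hp ih =>
    by_cases hpW : W.valuation (algebraMap B L p) < 1
    · exact ⟨p, hp, dvd_mul_right p a, hpW⟩
    · have hp1 := le_antisymm ((W.valuation_le_one_iff _).2 (hB p)) (not_lt.1 hpW)
      rw [map_mul, map_mul, hp1, one_mul] at hcW
      obtain ⟨h, h1, h2, h3⟩ := ih ha hcW
      exact ⟨h, h1, h2.mul_left p, h3⟩

end Localization

section ResidueDegree

/-- The residue degree of a finite place of `K(t)` is the degree of its irreducible polynomial. -/
theorem resDeg_eq_natDegree {L : Type} [Field L] {K : Subfield L} {t : L}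
    {R : ValuationSubring L} (htr : Transcendental K t)
    (hgen : ∀ M : Subfield L, K ≤ M → t ∈ M → M = ⊤)
    (hK : (K : Set L) ⊆ R) (ht : t ∈ R) {p : Polynomial K} (hp : Irreducible p)
    (hpR : R.valuation (Polynomial.aeval t p) < 1) : resDeg K R = p.natDegree := by
  rw [resDeg, dif_pos hK]
  let m := IsLocalRing.maximalIdeal R
  let i : K →+* R := Subring.inclusion (S := K.toSubring) (T := R.toSubring) hK
  let _ : Algebra K (R ⧸ m) := ((Ideal.Quotient.mk m).comp i).toAlgebra
  change Module.finrank K (R ⧸ m) = p.natDegree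
  let φ : Polynomial K →ₐ[K] R ⧸ m := Polynomial.aeval (Ideal.Quotient.mk m ⟨t, ht⟩)
  have hmem (u : Polynomial K) : Polynomial.aeval t u ∈ R :=
    (R.valuation_le_one_iff _).1 (valuation_aeval_le_one hK ht u)
  have hφ (u : Polynomial K) : φ u = Ideal.Quotient.mk m ⟨Polynomial.aeval t u, hmem u⟩ := by
    have h1 : φ u = Ideal.Quotient.mk m (Polynomial.eval₂ i ⟨t, ht⟩ u) := by
      rw [Polynomial.hom_eval₂]; rfl
    rw [h1]
    congr 1
    apply Subtype.ext
    change R.subtype _ = _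
    rw [Polynomial.hom_eval₂]; rfl
  have hφ0 (u : Polynomial K) : φ u = 0 ↔ p ∣ u := by
    rw [hφ, Ideal.Quotient.eq_zero_iff_mem, R.valuation_lt_one_iff,
      valuation_aeval_lt_one_iff_dvd hK ht hp hpR]
  have hker : RingHom.ker φ = Ideal.span {p} := by
    ext u
    rw [RingHom.mem_ker, hφ0, Ideal.mem_span_singleton]
  have hsurj : Function.Surjective φ := by
    intro y
    obtain ⟨⟨x, hx⟩, rfl⟩ := Ideal.Quotient.mk_surjective y
    obtain ⟨u, v, huv, hv, hxuv⟩ := exists_isCoprime_mul_aeval_eq htr hgen x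
    have hxv : Ideal.Quotient.mk m ⟨x, hx⟩ * φ v = φ u := by
      rw [hφ, hφ, ← map_mul]
      exact congrArg _ (Subtype.ext hxuv)
    have hpv : IsCoprime p v := by
      rw [hp.coprime_iff_not_dvd, ← hφ0]
      intro hv0
      have hu0 : φ u = 0 := by rw [← hxv, hv0, mul_zero]
      exact hp.not_isUnit (huv.isUnit_of_dvd' ((hφ0 u).1 hu0) ((hφ0 v).1 hv0))
    obtain ⟨a, b, hab⟩ := hpv
    have hbv : φ b * φ v = 1 := by
      have := congrArg φ hab
      rwa [map_add, map_mul, map_mul, map_one, (hφ0 p).2 dvd_rfl, mul_zero, zero_add] at this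
    refine ⟨u * b, ?_⟩
    rw [map_mul, ← hxv, mul_assoc, mul_comm (φ v), hbv, mul_one]
  rw [← (Ideal.quotientKerAlgEquivOfSurjective hsurj).toLinearEquiv.finrank_eq]
  rw [← finrank_quotient_span_eq_natDegree (f := p)]
  exact (Ideal.quotientEquivAlgOfEq K hker).toLinearEquiv.finrank_eq

end ResidueDegree

section Core

variable {L : Type*} [Field L] {K : Subfield L} {t : L}
variable {B : Type*} [CommRing B] [Algebra B L]

/-- If a place `p` of `K(t)` does not contain `B`, then `1 / p` lies in every valuation ring
containing `K` and `B`. -/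
theorem inv_aeval_mem_of_forall_algebraMap_mem (htr : Transcendental K t)
    (hgen : ∀ M : Subfield L, K ≤ M → t ∈ M → M = ⊤)
    {R : ValuationSubring L} (hK : (K : Set L) ⊆ R) (ht : t ∈ R)
    {p : Polynomial K} (hp : Irreducible p) (hpR : R.valuation (Polynomial.aeval t p) < 1)
    {b : B} (hb : algebraMap B L b ∉ R) {W : ValuationSubring L} (hKW : (K : Set L) ⊆ W)
    (hBW : ∀ b : B, algebraMap B L b ∈ W) : (Polynomial.aeval t p)⁻¹ ∈ W := by
  by_contra hW
  have hinj := transcendental_iff_injective.1 htr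
  have hp0 : Polynomial.aeval t p ≠ 0 := (map_ne_zero_iff _ hinj).2 hp.ne_zero
  have hpW : W.valuation (Polynomial.aeval t p) < 1 := by
    rw [← W.mem_nonunits_iff, W.mem_nonunits_iff_or]
    exact .inr hW
  have htW : t ∈ W := by
    by_contra htW
    have h1 : 1 < W.valuation t := by rwa [← not_le, W.valuation_le_one_iff]
    rw [valuation_aeval_eq_pow hKW htW hp.ne_zero] at hpW
    exact hpW.not_ge (one_le_pow₀ h1.le)
  obtain ⟨u, v, huv, hv, hbuv⟩ := exists_isCoprime_mul_aeval_eq htr hgen (algebraMap B L b)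
  have hvR : R.valuation (Polynomial.aeval t v) < 1 := by
    by_contra! h
    have h1 := le_antisymm (valuation_aeval_le_one hK ht v) h
    have h2 := congrArg R.valuation hbuv
    rw [map_mul, h1, mul_one] at h2
    exact hb ((R.valuation_le_one_iff _).1 (h2.trans_le (valuation_aeval_le_one hK ht u)))
  have hvW := (valuation_aeval_lt_one_iff_dvd hKW htW hp hpW).2
    ((valuation_aeval_lt_one_iff_dvd hK ht hp hpR).1 hvR)
  have huW := valuation_aeval_eq_one_of_isCoprime hKW htW huv hvW
  have h := congrArg W.valuation hbuv
  rw [map_mul, huW] at h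
  exact (mul_lt_one_of_nonneg_of_lt_one_right ((W.valuation_le_one_iff _).2 (hBW b))
    zero_le hvW).ne h

/-- The inverse of a linear polynomial in `t` generates `K(t)`. -/
theorem eq_top_of_inv_aeval_mem (hgen : ∀ M : Subfield L, K ≤ M → t ∈ M → M = ⊤)
    {p : Polynomial K} (hp : p.natDegree = 1) (M : Subfield L) (hKM : K ≤ M)
    (hpM : (Polynomial.aeval t p)⁻¹ ∈ M) : M = ⊤ := by
  obtain ⟨a, ha, c, rfl⟩ := Polynomial.natDegree_eq_one.1 hp
  refine hgen M hKM ?_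
  have h1 := M.inv_mem hpM
  rw [inv_inv] at h1
  simp only [map_add, map_mul, Polynomial.aeval_C, Polynomial.aeval_X] at h1
  have h2 : (a : L) ≠ 0 := fun h => ha (Subtype.ext h)
  have h3 : t = (a : L)⁻¹ * ((a : L) * t + c - c) := by
    rw [add_sub_cancel_right, inv_mul_cancel_left₀ h2]
  rw [h3]
  exact mul_mem (inv_mem (hKM a.2)) (sub_mem h1 (hKM c.2))

variable [IsFractionRing B L]

/-- If `K` and `B` lie in a valuation ring not containing `t`, then some nonconstant polynomial
in `t` has its inverse in every valuation ring containing `K` and `B`. -/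
theorem exists_natDegree_pos_forall_inv_aeval_mem (htr : Transcendental K t)
    (hgen : ∀ M : Subfield L, K ≤ M → t ∈ M → M = ⊤)
    {W₀ : ValuationSubring L} (hKW₀ : (K : Set L) ⊆ W₀) (hBW₀ : ∀ b : B, algebraMap B L b ∈ W₀)
    (htW₀ : t ∉ W₀) :
    ∃ v : Polynomial K, 0 < v.natDegree ∧ ∀ W : ValuationSubring L, (K : Set L) ⊆ W →
      (∀ b : B, algebraMap B L b ∈ W) → (Polynomial.aeval t v)⁻¹ ∈ W := by
  have hinj := transcendental_iff_injective.1 htr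
  have hT : 1 < W₀.valuation t := by rwa [← not_le, W₀.valuation_le_one_iff]
  have hex : ∃ b : B, algebraMap B L b ∉ K := by
    by_contra! h
    have htK : t ∈ K := by
      obtain ⟨a, s, -, has⟩ := IsFractionRing.div_surjective (A := B) t
      rw [← has]
      exact div_mem (h a) (h s)
    exact htr (isAlgebraic_algebraMap (⟨t, htK⟩ : K))
  obtain ⟨b, hbK⟩ := hex
  obtain ⟨u, v, huv, hv, hbuv⟩ := exists_isCoprime_mul_aeval_eq htr hgen (algebraMap B L b)
  have hv0 := (map_ne_zero_iff _ hinj).2 hv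
  have hvdeg : 0 < v.natDegree := by
    by_contra! hdeg
    have hdeg : v.natDegree = 0 := by omega
    refine hbK ?_
    have hu : u.natDegree = 0 := by
      by_contra hu
      have hu0 : u ≠ 0 := by rintro rfl; simp at hu
      have h := congrArg W₀.valuation hbuv
      rw [map_mul, valuation_aeval_eq_pow hKW₀ htW₀ hu0, valuation_aeval_eq_pow hKW₀ htW₀ hv,
        hdeg, pow_zero, mul_one] at h
      exact ((W₀.valuation_le_one_iff _).2 (hBW₀ b)).not_gt (h ▸ one_lt_pow₀ hT hu)
    obtain ⟨c, hc⟩ := Polynomial.natDegree_eq_zero.1 hdeg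
    obtain ⟨d, hd⟩ := Polynomial.natDegree_eq_zero.1 hu
    rw [eq_div_of_mul_eq hv0 hbuv, ← hc, ← hd, Polynomial.aeval_C, Polynomial.aeval_C]
    exact div_mem d.2 c.2
  refine ⟨v, hvdeg, fun W hKW hBW => ?_⟩
  by_cases htW : t ∈ W
  · by_contra hvW
    have hvW' : W.valuation (Polynomial.aeval t v) < 1 := by
      rw [← W.mem_nonunits_iff, W.mem_nonunits_iff_or]
      exact .inr hvW
    have h := congrArg W.valuation hbuv
    rw [map_mul, valuation_aeval_eq_one_of_isCoprime hKW htW huv hvW'] at h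
    exact (mul_lt_one_of_nonneg_of_lt_one_right ((W.valuation_le_one_iff _).2 (hBW b))
      zero_le hvW').ne h
  · have h1 : 1 < W.valuation t := by rwa [← not_le, W.valuation_le_one_iff]
    rw [← W.valuation_le_one_iff, map_inv₀, valuation_aeval_eq_pow hKW htW hv]
    exact inv_le_one_of_one_le₀ (one_le_pow₀ h1.le)

end Core

/-- Let `L = K(t)` be the fraction field of a factorial ring `B` such that `K` is the fraction
field of `B ∩ K`. If every place of `L / K` not containing `B` has degree `1` or a multiple of
`e > 1`, then some generator of `L / K` is a quotient of an element of `B` by one of `B ∩ K`. -/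
theorem exists_generator_of_resDeg {L : Type} [Field L] {K : Subfield L} {t : L}
    (htr : Transcendental K t) (hgen : ∀ M : Subfield L, K ≤ M → t ∈ M → M = ⊤)
    {B : Type*} [CommRing B] [IsDomain B] [UniqueFactorizationMonoid B] [Algebra B L]
    [IsFractionRing B L]
    (hS : ∀ x ∈ K, ∃ a b : B, algebraMap B L b ∈ K ∧ b ≠ 0 ∧
      x * algebraMap B L b = algebraMap B L a) {e : ℕ} (he : 1 < e)
    (hdeg : ∀ R : ValuationSubring L, (K : Set L) ⊆ R → R ≠ ⊤ →
      (∃ b : B, algebraMap B L b ∉ R) → resDeg K R = 1 ∨ e ∣ resDeg K R) :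
    ∃ x : L, (∀ M : Subfield L, K ≤ M → x ∈ M → M = ⊤) ∧
      ∃ s b : B, s ≠ 0 ∧ algebraMap B L s ∈ K ∧ algebraMap B L s * x = algebraMap B L b := by
  have hinj := transcendental_iff_injective.1 htr
  have hBinj := IsFractionRing.injective B L
  by_cases hlin : ∃ (p : Polynomial K) (R : ValuationSubring L), Irreducible p ∧
      p.natDegree = 1 ∧ (K : Set L) ⊆ R ∧ t ∈ R ∧ R.valuation (Polynomial.aeval t p) < 1 ∧
      ∃ b : B, algebraMap B L b ∉ R
  · obtain ⟨p, R, hp, hp1, hKR, htR, hpR, b, hb⟩ := hlin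
    exact ⟨(Polynomial.aeval t p)⁻¹, eq_top_of_inv_aeval_mem hgen hp1,
      exists_mul_eq_of_forall_valuationSubring hS fun W hKW hBW =>
        inv_aeval_mem_of_forall_algebraMap_mem htr hgen hKR htR hp hpR hb hKW hBW⟩
  refine ⟨t, hgen, ?_⟩
  by_cases htall : ∀ W : ValuationSubring L, (K : Set L) ⊆ W →
      (∀ b : B, algebraMap B L b ∈ W) → t ∈ W
  · exact exists_mul_eq_of_forall_valuationSubring hS htall
  push Not at htall
  obtain ⟨W₀, hKW₀, hBW₀, htW₀⟩ := htall
  have hT : 1 < W₀.valuation t := by rwa [← not_le, W₀.valuation_le_one_iff]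
  obtain ⟨v, hvdeg, hvmem⟩ :=
    exists_natDegree_pos_forall_inv_aeval_mem htr hgen hKW₀ hBW₀ htW₀
  have hv : v ≠ 0 := by rintro rfl; simp at hvdeg
  have hv0 := (map_ne_zero_iff _ hinj).2 hv
  obtain ⟨s, c, hs, hsK, hsc⟩ := exists_mul_eq_of_forall_valuationSubring hS hvmem
  have hsL : algebraMap B L s ≠ 0 := (map_ne_zero_iff _ hBinj).2 hs
  have hcv : algebraMap B L c * Polynomial.aeval t v = algebraMap B L s := by
    rw [← hsc, inv_mul_cancel_right₀ hv0]
  have hc : c ≠ 0 := by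
    rintro rfl
    rw [map_zero, zero_mul] at hcv
    exact hsL hcv.symm
  have hcW₀ : W₀.valuation (algebraMap B L c) < 1 := by
    by_contra! h
    have h1 := congrArg W₀.valuation hcv
    rw [map_mul, valuation_aeval_eq_pow hKW₀ htW₀ hv,
      valuation_eq_one_of_mem_subfield hKW₀ hsK hsL] at h1
    have h2 := one_lt_pow₀ hT hvdeg.ne'
    exact h1.not_gt (h2.trans_le (le_mul_of_one_le_left zero_le h))
  obtain ⟨h, hh, ⟨h', hch⟩, hhW₀⟩ := exists_prime_dvd_valuation_lt_one hBW₀ hc hcW₀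
  obtain ⟨a, q, haq, hq, hhaq⟩ := exists_isCoprime_mul_aeval_eq htr hgen (algebraMap B L h)
  have hhL : algebraMap B L h ≠ 0 := (map_ne_zero_iff _ hBinj).2 hh.ne_zero
  have ha : a ≠ 0 := by
    rintro rfl
    rw [map_zero] at hhaq
    exact mul_ne_zero hhL ((map_ne_zero_iff _ hinj).2 hq) hhaq
  have hplace (p : Polynomial K) (hp : Irreducible p) (hpaq : p ∣ a ∨ p ∣ q) :
      e ∣ p.natDegree := by
    obtain ⟨R, hKR, htR, hpR⟩ := exists_valuationSubring_aeval_lt_one htr hp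
    have hBR : ∃ b : B, algebraMap B L b ∉ R := by
      by_contra! hBR
      have hle (b : B) : R.valuation (algebraMap B L b) ≤ 1 := (R.valuation_le_one_iff _).2 (hBR b)
      have hs1 := valuation_eq_one_of_mem_subfield hKR hsK hsL
      rw [← hcv, hch] at hs1
      simp only [map_mul, mul_assoc] at hs1
      have hh1 : R.valuation (algebraMap B L h) = 1 := by
        refine le_antisymm (hle h) (not_lt.1 fun hlt => ?_)
        exact (mul_lt_one_of_lt_of_le hlt (mul_le_one' (hle h')
          (valuation_aeval_le_one hKR htR v))).ne hs1
      have hqa := congrArg R.valuation hhaq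
      rw [map_mul, hh1, one_mul] at hqa
      have hlt_iff := fun w => valuation_aeval_lt_one_iff_dvd (u := w) hKR htR hp hpR
      have hboth : p ∣ a ∧ p ∣ q := by
        rw [← hlt_iff, ← hlt_iff, hqa, and_self]
        rw [← hlt_iff, ← hlt_iff, hqa, or_self] at hpaq
        exact hpaq
      exact hp.not_isUnit (haq.isUnit_of_dvd' hboth.1 hboth.2)
    have hRtop : R ≠ ⊤ := by
      rintro rfl
      have hp0 := (map_ne_zero_iff _ hinj).2 hp.ne_zero
      have := (ValuationSubring.mem_nonunits_iff_or (A := (⊤ : ValuationSubring L))).1 hpR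
      exact this.elim hp0 fun h => h (ValuationSubring.mem_top _)
    have := hdeg R hKR hRtop hBR
    rw [resDeg_eq_natDegree htr hgen hKR htR hp hpR] at this
    exact this.resolve_left fun h1 => hlin ⟨p, R, hp, h1, hKR, htR, hpR, hBR⟩
  have hea := dvd_natDegree_of_forall_irreducible ha fun p hp hpa => hplace p hp (.inl hpa)
  have heq := dvd_natDegree_of_forall_irreducible hq fun p hp hpq => hplace p hp (.inr hpq)
  have hval (W : ValuationSubring L) (hKW : (K : Set L) ⊆ W) (htW : t ∉ W) :
      W.valuation (algebraMap B L h) * W.valuation t ^ q.natDegree =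
        W.valuation t ^ a.natDegree := by
    rw [← valuation_aeval_eq_pow hKW htW ha, ← valuation_aeval_eq_pow hKW htW hq, ← map_mul, hhaq]
  have hlt : a.natDegree < q.natDegree := by
    rw [← pow_lt_pow_iff_right₀ hT, ← hval W₀ hKW₀ htW₀]
    exact mul_lt_of_lt_one_left (pow_pos (zero_lt_one.trans hT) _) hhW₀
  have hle : 2 + a.natDegree ≤ q.natDegree := by
    have := Nat.le_of_dvd (Nat.sub_pos_of_lt hlt) (Nat.dvd_sub heq hea)
    omega
  have hz (W : ValuationSubring L) (hKW : (K : Set L) ⊆ W)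
      (hBW : ∀ b : B, algebraMap B L b ∈ W) : algebraMap B L h * t ^ 2 ∈ W := by
    by_cases htW : t ∈ W
    · exact mul_mem (hBW h) (pow_mem htW 2)
    have h1 : 1 < W.valuation t := by rwa [← not_le, W.valuation_le_one_iff]
    rw [← W.valuation_le_one_iff, map_mul, map_pow]
    refine le_of_mul_le_mul_right ?_ (pow_pos (zero_lt_one.trans h1) a.natDegree)
    rw [one_mul, mul_assoc, ← pow_add, ← hval W hKW htW]
    exact mul_le_mul_right (pow_le_pow_right₀ h1.le hle) _
  have hy (W : ValuationSubring L) (hKW : (K : Set L) ⊆ W)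
      (hBW : ∀ b : B, algebraMap B L b ∈ W) : algebraMap B L h * t ∈ W := by
    by_cases htW : t ∈ W
    · exact mul_mem (hBW h) htW
    have h1 : 1 < W.valuation t := by rwa [← not_le, W.valuation_le_one_iff]
    have h2 := (W.valuation_le_one_iff _).2 (hz W hKW hBW)
    rw [pow_two, ← mul_assoc, map_mul] at h2
    exact (W.valuation_le_one_iff _).1 ((le_mul_of_one_le_right zero_le h1.le).trans h2)
  obtain ⟨s₁, y, hs₁, hs₁K, hy⟩ := exists_mul_eq_of_forall_valuationSubring hS hy
  obtain ⟨s₂, z, hs₂, hs₂K, hz⟩ := exists_mul_eq_of_forall_valuationSubring hS hz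
  have hyz : y ^ 2 * s₂ = h * (s₁ ^ 2 * z) := by
    apply hBinj
    simp only [map_mul, map_pow, ← hy, ← hz]
    ring
  have hs₂h : ¬ h ∣ s₂ := by
    rintro ⟨b, rfl⟩
    have h1 := valuation_eq_one_of_mem_subfield hKW₀ hs₂K ((map_ne_zero_iff _ hBinj).2 hs₂)
    rw [map_mul, map_mul] at h1
    exact (mul_lt_one_of_lt_of_le hhW₀ ((W₀.valuation_le_one_iff _).2 (hBW₀ b))).ne h1
  obtain ⟨y', rfl⟩ := hh.dvd_of_dvd_pow
    ((hh.dvd_or_dvd (Dvd.intro _ hyz.symm)).resolve_right hs₂h)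
  refine ⟨s₁, y', hs₁, hs₁K, mul_left_cancel₀ hhL ?_⟩
  rw [← map_mul, ← hy]
  ring

open scoped IntermediateField.algebraAdjoinAdjoin in
/-- If `L = k(f, t)` has transcendence degree at least two over `k`, then `t` is transcendental
over `k(f)`. -/
theorem transcendental_adjoin_of_adjoin_pair_eq_top {k L : Type} [Field k] [Field L] [Algebra k L]
    {x : Fin 2 → L} (hx : AlgebraicIndependent k x) {f t : L}
    (ht : IntermediateField.adjoin k {f, t} = ⊤) :
    Transcendental (IntermediateField.adjoin k {f}) t := by
  intro halg
  let E := IntermediateField.adjoin k {f}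
  have hEt : IntermediateField.adjoin E {t} = ⊤ := by
    apply IntermediateField.restrictScalars_injective k
    rw [IntermediateField.adjoin_simple_adjoin_simple, ht, IntermediateField.restrictScalars_top]
  have h1 : Algebra.IsAlgebraic E L := by
    have := IntermediateField.isAlgebraic_adjoin_simple halg.isIntegral
    rw [hEt] at this
    exact IntermediateField.topEquiv.isAlgebraic
  have h2 : Algebra.IsAlgebraic (Algebra.adjoin k {f}) L :=
    Algebra.IsAlgebraic.trans (Algebra.adjoin k {f}) E L
  have h3 := hx.cardinalMk_le_trdeg.trans (Algebra.IsAlgebraic.trdeg_le_cardinalMk k ({f} : Set L))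
  rw [Cardinal.mk_singleton, Cardinal.mk_fin] at h3
  exact absurd h3 (by norm_num)

/-- Let `F` be a field generator of `A = k[X,Y]` with dicritical degree list
`Δ(F,A) = [d₁,…,d_t]` (the residue degrees over the valuation rings `R` of `Frac(A)/k(F)`
with `A ⊄ R`). If the gcd of the entries different from `1` is `> 1` (expressed as: some
`e > 1` divides every entry that is not `1`), then `F` is a very good field generator:
for every polynomial subring `A' = k[U,V] ⊆ A` with `Frac A' = Frac A` and `F ∈ A'`,
`F` is a good field generator of `A'`. -/
theorem stmt16 (k : Type) [Field k] (L : Type) [Field L]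
    [Algebra (MvPolynomial (Fin 2) k) L] [IsFractionRing (MvPolynomial (Fin 2) k) L]
    [Algebra k L] [IsScalarTower k (MvPolynomial (Fin 2) k) L]
    (F : MvPolynomial (Fin 2) k)
    (hFG : ∃ g : L, IntermediateField.adjoin k
        {algebraMap (MvPolynomial (Fin 2) k) L F, g} = ⊤)
    (hgcd : ∃ e : ℕ, 1 < e ∧
      ∀ R : ValuationSubring L,
        ((Subfield.closure (Set.range (algebraMap k L)
            ∪ {algebraMap (MvPolynomial (Fin 2) k) L F}) : Subfield L) : Set L) ⊆ (R : Set L) →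
        R ≠ ⊤ → (∃ a : MvPolynomial (Fin 2) k, algebraMap (MvPolynomial (Fin 2) k) L a ∉ R) →
        (resDeg (Subfield.closure (Set.range (algebraMap k L)
            ∪ {algebraMap (MvPolynomial (Fin 2) k) L F})) R = 1 ∨
         e ∣ resDeg (Subfield.closure (Set.range (algebraMap k L)
            ∪ {algebraMap (MvPolynomial (Fin 2) k) L F})) R)) :
    ∀ B : Subalgebra k (MvPolynomial (Fin 2) k),
      Nonempty (B ≃ₐ[k] MvPolynomial (Fin 2) k) →
      (∀ x : L, ∃ p q : B, q ≠ 0 ∧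
        x * algebraMap (MvPolynomial (Fin 2) k) L q = algebraMap (MvPolynomial (Fin 2) k) L p) →
      F ∈ B →
      ∃ G ∈ B, IntermediateField.adjoin k
        {algebraMap (MvPolynomial (Fin 2) k) L F,
         algebraMap (MvPolynomial (Fin 2) k) L G} = ⊤ := by
  intro B ⟨φ⟩ hfrac hFB
  obtain ⟨t, ht⟩ := hFG
  obtain ⟨e, he, hdeg⟩ := hgcd
  set f : L := algebraMap (MvPolynomial (Fin 2) k) L F with hf
  have hAinj := IsFractionRing.injective (MvPolynomial (Fin 2) k) L
  have hX := (MvPolynomial.algebraicIndependent_X (Fin 2) k).map'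
    (f := IsScalarTower.toAlgHom k (MvPolynomial (Fin 2) k) L) hAinj
  set K : Subfield L := Subfield.closure (Set.range (algebraMap k L) ∪ {f}) with hK
  have htr : Transcendental K t := transcendental_adjoin_of_adjoin_pair_eq_top hX ht
  have hpair (g : L) (M : Subfield L) (hKM : K ≤ M) (hg : g ∈ M) :
      (IntermediateField.adjoin k {f, g}).toSubfield ≤ M := by
    rw [IntermediateField.adjoin_toSubfield, Subfield.closure_le]
    have hsub := Subfield.closure_le.1 hKM
    rintro y (hy | rfl | rfl)
    exacts [hsub (.inl hy), hsub (.inr rfl), hg]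
  have hgen (M : Subfield L) (hKM : K ≤ M) (htM : t ∈ M) : M = ⊤ := by
    have h1 := hpair t M hKM htM
    rw [ht] at h1
    exact top_le_iff.1 h1
  have : UniqueFactorizationMonoid B :=
    φ.toMulEquiv.symm.uniqueFactorizationMonoid inferInstance
  have hBinj : Function.Injective (algebraMap B L) := hAinj.comp Subtype.val_injective
  have : IsFractionRing B L := by
    have : FaithfulSMul B L := (faithfulSMul_iff_algebraMap_injective B L).2 hBinj
    refine IsFractionRing.of_field B L fun x => ?_
    obtain ⟨p, q, hq, hpq⟩ := hfrac x
    exact ⟨p, q, (eq_div_of_mul_eq ((map_ne_zero_iff _ hBinj).2 hq) hpq)⟩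
  have hS : ∀ x ∈ K, ∃ a b : B, algebraMap B L b ∈ K ∧ b ≠ 0 ∧
      x * algebraMap B L b = algebraMap B L a := by
    intro x hx
    obtain ⟨r, s, hrs⟩ := (IntermediateField.mem_adjoin_simple_iff k x).1 hx
    have hB (w : Polynomial k) :
        algebraMap B L (Polynomial.aeval ⟨F, hFB⟩ w) = Polynomial.aeval f w :=
      (Polynomial.aeval_algebraMap_apply L (⟨F, hFB⟩ : B) w).symm
    by_cases hs : Polynomial.aeval f s = 0
    · exact ⟨0, 1, by simp [K.one_mem], one_ne_zero, by simp [hrs, hs]⟩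
    refine ⟨Polynomial.aeval ⟨F, hFB⟩ r, Polynomial.aeval ⟨F, hFB⟩ s, ?_, ?_, ?_⟩
    · rw [hB]
      exact IntermediateField.algebra_adjoin_le_adjoin k {f}
        (Polynomial.aeval_mem_adjoin_singleton k f)
    · intro h
      rw [← hB, h, map_zero] at hs
      exact hs rfl
    · rw [hB, hB, hrs, div_mul_cancel₀ _ hs]
  obtain ⟨x, hxgen, s, b, hs, hsK, hsb⟩ := exists_generator_of_resDeg htr hgen hS he
    fun R hKR hR ⟨b, hb⟩ => hdeg R hKR hR ⟨b, hb⟩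
  refine ⟨b, b.2, ?_⟩
  let M := IntermediateField.adjoin k {f, algebraMap (MvPolynomial (Fin 2) k) L b}
  have hKM : K ≤ M.toSubfield := Subfield.closure_mono (by gcongr; simp)
  have hbM : algebraMap B L b ∈ M :=
    IntermediateField.subset_adjoin k _ (Set.mem_insert_of_mem _ rfl)
  have hxM : x ∈ M.toSubfield := by
    have h1 := div_mem hbM (hKM hsK)
    rwa [← hsb, mul_div_cancel_left₀ _ ((map_ne_zero_iff _ hBinj).2 hs)] at h1
  have h1 := hxgen M.toSubfield hKM hxM
  exact top_le_iff.1 fun y _ => h1.ge (Subfield.mem_top y)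
end
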